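/- arXiv:1706.03573 — 2 statements merged into one kernel-verified Lean document; each statement's English description precedes it below -/
import Mathlib

section
/- Let $C \subset \mathbb{R}^n$ be a pointed closed convex cone with nonempty interior, and let $A_0, A_1$ be $C$-coconvex sets. If equality holds in the inequality $V_n((1-\lambda)A_0 \oplus \lambda A_1)^{1/n} \le (1-\lambda)V_n(A_0)^{1/n} + \lambda V_n(A_1)^{1/n}$ for some $\lambda \in (0,1)$, then $A_0 = \alpha A_1$ for some $\alpha > 0$. -/
open Set Pointwise MeasureTheory


/-- The radial (star-shaped) open set with radial function `h`. -/
def starSet {E : Type*} [NormedAddCommGroup E] [NormedSpace ℝ E]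
    (h : Metric.sphere (0 : E) 1 → ℝ) : Set E :=
  {x | ∃ u : Metric.sphere (0 : E) 1, ∃ r : ℝ, 0 < r ∧ r < h u ∧ x = r • (u : E)}

lemma volume_starSet {E : Type*} [NormedAddCommGroup E] [NormedSpace ℝ E] [MeasurableSpace E]
    [BorelSpace E] [FiniteDimensional ℝ E] [Nontrivial E] (μ : Measure E) [μ.IsAddHaarMeasure]
    (h : Metric.sphere (0 : E) 1 → ℝ) (hm : Measurable h) (h0 : ∀ u, 0 ≤ h u) :
    μ (starSet h) = ∫⁻ u, ENNReal.ofReal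
      ((h u) ^ (Module.finrank ℝ E) / (Module.finrank ℝ E)) ∂μ.toSphere := by
  have hN : 0 < Module.finrank ℝ E := Module.finrank_pos
  set S : Set (Metric.sphere (0 : E) 1 × Ioi (0 : ℝ)) := {p | (p.2 : ℝ) < h p.1} with hS
  have hSm : MeasurableSet S :=
    measurableSet_lt (measurable_subtype_coe.comp measurable_snd) (hm.comp measurable_fst)
  have h1 : starSet h = Subtype.val '' ((homeomorphUnitSphereProd E) ⁻¹' S) := by
    rw [← Homeomorph.image_symm, image_image]
    ext x
    constructor
    · rintro ⟨u, r, hr, hru, rfl⟩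
      exact ⟨(u, ⟨r, hr⟩), hru, by simp⟩
    · rintro ⟨⟨u, r⟩, hr, rfl⟩
      exact ⟨u, r, r.2, hr, by simp⟩
  rw [h1, ← comap_subtype_coe_apply (measurableSet_singleton _).compl,
    μ.measurePreserving_homeomorphUnitSphereProd.measure_preimage hSm.nullMeasurableSet,
    Measure.prod_apply hSm]
  refine lintegral_congr fun u => ?_
  rcases (h0 u).eq_or_lt with h' | h'
  · have : Prod.mk u ⁻¹' S = ∅ := by
      ext r
      simp only [hS, mem_preimage, mem_ofPred_eq, ← h', mem_empty_iff_false, iff_false, not_lt]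
      exact r.2.out.le
    rw [this, ← h']
    simp [hN.ne']
  · have : Prod.mk u ⁻¹' S = Iio (⟨h u, h'⟩ : Ioi (0 : ℝ)) := by
      ext r
      simp [hS, ← Subtype.coe_lt_coe]
    rw [this, Measure.volumeIoiPow_apply_Iio]
    simp only
    rw [Nat.sub_add_cancel hN, Nat.cast_pred hN, sub_add_cancel]

lemma real_conv {n : ℕ} (hn : 2 ≤ n) {p q a b l : ℝ} (hp : 0 ≤ p) (hq : 0 ≤ q) (ha : 0 < a)
    (hb : 0 < b) (hl0 : 0 < l) (hl1 : l < 1) :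
    ((1 - l) * p + l * q) ^ n ≤ ((1 - l) * a + l * b) ^ n *
      (((1 - l) * a / ((1 - l) * a + l * b)) * (p / a) ^ n
        + (l * b / ((1 - l) * a + l * b)) * (q / b) ^ n) ∧
    (((1 - l) * p + l * q) ^ n = ((1 - l) * a + l * b) ^ n *
      (((1 - l) * a / ((1 - l) * a + l * b)) * (p / a) ^ n
        + (l * b / ((1 - l) * a + l * b)) * (q / b) ^ n) → p / a = q / b) := by
  have hl : 0 < 1 - l := by linarith
  set s := (1 - l) * a + l * b with hs
  have hspos : 0 < s := by positivity
  have key : (1 - l) * p + l * q = s * (((1 - l) * a / s) * (p / a) + (l * b / s) * (q / b)) := by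
    field_simp
  have hw : (1 - l) * a / s + l * b / s = 1 := by
    rw [← add_div, div_self hspos.ne']
  rw [key, mul_pow]
  constructor
  · gcongr
    exact (convexOn_pow n).2 (mem_Ici.2 (by positivity : 0 ≤ p / a))
      (mem_Ici.2 (by positivity : 0 ≤ q / b)) (by positivity) (by positivity) hw
  · intro h
    by_contra hne
    have h2 := (strictConvexOn_pow hn).2 (mem_Ici.2 (by positivity : 0 ≤ p / a))
      (mem_Ici.2 (by positivity : 0 ≤ q / b)) hne (by positivity : 0 < (1 - l) * a / s)
      (by positivity : 0 < l * b / s) hw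
    have h3 := mul_left_cancel₀ (pow_ne_zero n hspos.ne') h
    simp only [smul_eq_mul] at h2
    linarith

lemma volume_open_cone {n : ℕ} (hn : n ≠ 0) (W : Set (EuclideanSpace ℝ (Fin n)))
    (hW : IsOpen W) (hne : W.Nonempty) (hc : ∀ x ∈ W, (2 : ℝ) • x ∈ W) : volume W = ⊤ := by
  by_contra hfin
  have h1 : (2 : ℝ) • W ⊆ W := by
    rintro _ ⟨x, hx, rfl⟩
    exact hc x hx
  have h2 := measure_mono (μ := volume) h1
  rw [Measure.addHaar_smul] at h2
  have h0 : 0 < volume W := hW.measure_pos _ hne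
  have h3 : (volume W).toReal * 2 ^ n ≤ (volume W).toReal := by
    have := ENNReal.toReal_mono hfin h2
    rw [ENNReal.toReal_mul, ENNReal.toReal_ofReal (by positivity)] at this
    simp at this
    linarith
  have h4 : 0 < (volume W).toReal := ENNReal.toReal_pos h0.ne' hfin
  have h5 : (1 : ℝ) < 2 ^ n := one_lt_pow₀ (by norm_num) hn
  nlinarith

section
variable {n : ℕ} {C K : Set (EuclideanSpace ℝ (Fin n))}

lemma cone_add (hC_conv : Convex ℝ C)
    (hC_cone : ∀ x ∈ C, ∀ r : ℝ, 0 ≤ r → r • x ∈ C) {x y : EuclideanSpace ℝ (Fin n)}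
    (hx : x ∈ C) (hy : y ∈ C) : x + y ∈ C := by
  have h := hC_conv hx hy (by norm_num : (0 : ℝ) ≤ 1 / 2) (by norm_num : (0 : ℝ) ≤ 1 / 2)
    (by norm_num)
  have h2 := hC_cone _ h 2 (by norm_num)
  rwa [smul_add, smul_smul, smul_smul, show (2 : ℝ) * (1 / 2) = 1 by norm_num, one_smul,
    one_smul] at h2

lemma int_smul (hC_cone : ∀ x ∈ C, ∀ r : ℝ, 0 ≤ r → r • x ∈ C) {x : EuclideanSpace ℝ (Fin n)}
    (hx : x ∈ interior C) {r : ℝ} (hr : 0 < r) : r • x ∈ interior C := by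
  have h1 : r • interior C ⊆ interior C := by
    apply interior_maximal _ (isOpen_interior.smul₀ hr.ne')
    rintro _ ⟨y, hy, rfl⟩
    exact hC_cone y (interior_subset hy) r hr.le
  exact h1 (smul_mem_smul_set hx)

lemma K_nonempty (hn : n ≠ 0) 
    (hC_cone : ∀ x ∈ C, ∀ r : ℝ, 0 ≤ r → r • x ∈ C) (hC_int : (interior C).Nonempty)
    (hfin : volume (C \ K) < ⊤) : K.Nonempty := by
  by_contra h
  rw [not_nonempty_iff_eq_empty] at h
  subst h
  rw [sdiff_empty] at hfin
  have := volume_open_cone hn (interior C) isOpen_interior hC_int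
    (fun x hx => int_smul hC_cone hx two_pos)
  exact (this ▸ (measure_mono interior_subset).trans_lt hfin).ne rfl

lemma K_add (hn : n ≠ 0) (hC_closed : IsClosed C) (hC_conv : Convex ℝ C)
    (hC_cone : ∀ x ∈ C, ∀ r : ℝ, 0 ≤ r → r • x ∈ C) (hC_int : (interior C).Nonempty)
    (hKC : K ⊆ C) (hKclosed : IsClosed K) (hKconv : Convex ℝ K)
    (hfin : volume (C \ K) < ⊤) {x c : EuclideanSpace ℝ (Fin n)} (hx : x ∈ K) (hc : c ∈ C) :
    x + c ∈ K := by
  have main : ∀ c ∈ interior C, x + c ∈ K := by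
    intro c hc
    by_contra hxc
    obtain ⟨f, s, hf, hs⟩ := geometric_hahn_banach_closed_point hKconv hKclosed hxc
    have hfc : 0 < f c := by
      have := hf x hx
      rw [map_add] at hs
      linarith
    have hW := volume_open_cone hn (interior C ∩ f ⁻¹' (Ioi 0))
      (isOpen_interior.inter (isOpen_Ioi.preimage f.continuous)) ⟨c, hc, hfc⟩
      (by
        rintro y ⟨hy, hfy⟩
        refine ⟨int_smul hC_cone hy two_pos, ?_⟩
        simp only [mem_preimage, mem_Ioi] at hfy
        simp [hfy])
    have hsub : (fun y => (x + c) + y) '' (interior C ∩ f ⁻¹' (Ioi 0)) ⊆ C \ K := by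
      rintro _ ⟨y, ⟨hy, hfy⟩, rfl⟩
      simp only [mem_preimage, mem_Ioi] at hfy
      refine ⟨cone_add hC_conv hC_cone (cone_add hC_conv hC_cone (hKC hx) (interior_subset hc))
        (interior_subset hy), fun hmem => ?_⟩
      have := hf _ hmem
      simp only [map_add] at this hs
      linarith
    have h2 := measure_mono (μ := volume) hsub
    rw [image_add_left, measure_preimage_add, hW] at h2
    exact absurd (h2.trans_lt hfin) (lt_irrefl _)
  have hcl : closure (interior C) = C := by
    rw [hC_conv.closure_interior_eq_closure_of_nonempty_interior hC_int, hC_closed.closure_eq]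
  have hT : IsClosed {c | x + c ∈ K} := hKclosed.preimage (by fun_prop)
  have : closure (interior C) ⊆ {c | x + c ∈ K} := closure_minimal main hT
  exact this (hcl.symm ▸ hc)

open Classical in
/-- radial function -/
noncomputable def rad (C K : Set (EuclideanSpace ℝ (Fin n)))
    (u : Metric.sphere (0 : EuclideanSpace ℝ (Fin n)) 1) : ℝ :=
  if (u : EuclideanSpace ℝ (Fin n)) ∈ interior C then
    sInf {r : ℝ | 0 ≤ r ∧ r • (u : EuclideanSpace ℝ (Fin n)) ∈ K} else 0

lemma rad_spec (hC_cone : ∀ x ∈ C, ∀ r : ℝ, 0 ≤ r → r • x ∈ C)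
    (hne : K.Nonempty) (hKclosed : IsClosed K) (h0 : (0 : EuclideanSpace ℝ (Fin n)) ∉ K)
    (hadd : ∀ x ∈ K, ∀ c ∈ C, x + c ∈ K)
    (u : Metric.sphere (0 : EuclideanSpace ℝ (Fin n)) 1)
    (hu : (u : EuclideanSpace ℝ (Fin n)) ∈ interior C) :
    0 < rad C K u ∧ ∀ r : ℝ, 0 < r → (r • (u : EuclideanSpace ℝ (Fin n)) ∈ K ↔ rad C K u ≤ r) := by
  set T : Set ℝ := {r : ℝ | 0 ≤ r ∧ r • (u : EuclideanSpace ℝ (Fin n)) ∈ K} with hT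
  have hrad : rad C K u = sInf T := by simp [rad, hu, hT]
  have hTc : IsClosed T := by
    rw [hT]
    exact isClosed_Ici.inter (hKclosed.preimage (by fun_prop))
  have hTb : BddBelow T := ⟨0, fun r hr => hr.1⟩
  have hTne : T.Nonempty := by
    obtain ⟨x, hx⟩ := hne
    have ht : Filter.Tendsto (fun t : ℝ => (u : EuclideanSpace ℝ (Fin n)) - t • x)
        (nhdsWithin 0 (Ioi 0)) (nhds (u : EuclideanSpace ℝ (Fin n))) := by
      have : Continuous (fun t : ℝ => (u : EuclideanSpace ℝ (Fin n)) - t • x) := by fun_prop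
      have h := this.tendsto 0
      simp only [zero_smul, sub_zero] at h
      exact h.mono_left nhdsWithin_le_nhds
    have hev := ht.eventually (isOpen_interior.mem_nhds hu)
    obtain ⟨t, htC, htpos⟩ := (hev.and self_mem_nhdsWithin).exists
    replace htpos : 0 < t := htpos
    refine ⟨t⁻¹, by positivity, ?_⟩
    have h1 := hC_cone _ (interior_subset htC) t⁻¹ (by positivity)
    have h2 := hadd x hx _ h1
    rwa [smul_sub, smul_smul, inv_mul_cancel₀ htpos.ne', one_smul, add_sub_cancel] at h2
  have hmem : sInf T ∈ T := hTc.csInf_mem hTne hTb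
  rw [hrad]
  constructor
  · rcases hmem.1.eq_or_lt with h | h
    · exfalso
      have := hmem.2
      rw [← h, zero_smul] at this
      exact h0 this
    · exact h
  · intro r hr
    constructor
    · intro h
      exact csInf_le hTb ⟨hr.le, h⟩
    · intro h
      have h1 := hadd _ hmem.2 _ (hC_cone _ (interior_subset hu) (r - sInf T) (by linarith))
      rwa [← add_smul, add_sub_cancel] at h1

lemma rad_out (u : Metric.sphere (0 : EuclideanSpace ℝ (Fin n)) 1)
    (hu : (u : EuclideanSpace ℝ (Fin n)) ∉ interior C) : rad C K u = 0 := by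
  simp [rad, hu]

lemma rad_measurable (hKclosed : IsClosed K) 
    (hs : ∀ u : Metric.sphere (0 : EuclideanSpace ℝ (Fin n)) 1,
      (u : EuclideanSpace ℝ (Fin n)) ∈ interior C → 0 < rad C K u ∧
        ∀ r : ℝ, 0 < r → (r • (u : EuclideanSpace ℝ (Fin n)) ∈ K ↔ rad C K u ≤ r)) :
    Measurable (rad C K) := by
  have hU : MeasurableSet {u : Metric.sphere (0 : EuclideanSpace ℝ (Fin n)) 1 |
      (u : EuclideanSpace ℝ (Fin n)) ∈ interior C} :=
    (isOpen_interior.preimage continuous_subtype_val).measurableSet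
  apply measurable_of_Iic
  intro t
  rcases lt_trichotomy t 0 with ht | ht | ht
  · convert MeasurableSet.empty
    ext u
    simp only [mem_preimage, mem_Iic, mem_empty_iff_false, iff_false, not_le]
    by_cases hu : (u : EuclideanSpace ℝ (Fin n)) ∈ interior C
    · linarith [(hs u hu).1]
    · rw [rad_out u hu]; exact ht
  · convert hU.compl using 1
    ext u
    simp only [mem_preimage, mem_Iic, mem_compl_iff, mem_ofPred_eq, ht]
    by_cases hu : (u : EuclideanSpace ℝ (Fin n)) ∈ interior C
    · simp [hu, (hs u hu).1]
    · simp [rad_out u hu, hu]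
  · have h2 : MeasurableSet {u : Metric.sphere (0 : EuclideanSpace ℝ (Fin n)) 1 |
        t • (u : EuclideanSpace ℝ (Fin n)) ∈ K} :=
      (hKclosed.preimage (by fun_prop : Continuous
        fun u : Metric.sphere (0 : EuclideanSpace ℝ (Fin n)) 1 =>
          t • (u : EuclideanSpace ℝ (Fin n)))).measurableSet
    convert hU.compl.union h2 using 1
    ext u
    simp only [mem_preimage, mem_Iic, mem_union, mem_compl_iff, mem_ofPred_eq]
    by_cases hu : (u : EuclideanSpace ℝ (Fin n)) ∈ interior C
    · simp [hu, (hs u hu).2 t ht]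
    · simp [rad_out u hu, hu, ht.le]

lemma volume_diff_interior (hC_conv : Convex ℝ C) :
    volume (C \ K) = volume (interior C \ K) := by
  apply le_antisymm _ (measure_mono (sdiff_subset_sdiff_left interior_subset))
  have h : C \ K ⊆ (interior C \ K) ∪ frontier C := by
    rintro x ⟨hx, hxK⟩
    by_cases hi : x ∈ interior C
    · exact Or.inl ⟨hi, hxK⟩
    · exact Or.inr ⟨subset_closure hx, hi⟩
  refine (measure_mono h).trans ((measure_union_le _ _).trans ?_)
  rw [hC_conv.addHaar_frontier volume, add_zero]

lemma polar_mem {x : EuclideanSpace ℝ (Fin n)} (hx : x ≠ 0) :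
    ∃ u : Metric.sphere (0 : EuclideanSpace ℝ (Fin n)) 1, ∃ r : ℝ, 0 < r ∧
      x = r • (u : EuclideanSpace ℝ (Fin n)) := by
  have h : 0 < ‖x‖ := norm_pos_iff.2 hx
  refine ⟨⟨‖x‖⁻¹ • x, by simp [norm_smul, h.ne']⟩, ‖x‖, h, ?_⟩
  simp [smul_smul, h.ne']

lemma int_smul_iff (hC_cone : ∀ x ∈ C, ∀ r : ℝ, 0 ≤ r → r • x ∈ C)
    {x : EuclideanSpace ℝ (Fin n)} {r : ℝ} (hr : 0 < r) :
    r • x ∈ interior C ↔ x ∈ interior C := by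
  refine ⟨fun h => ?_, fun h => int_smul hC_cone h hr⟩
  have := int_smul hC_cone h (inv_pos.2 hr)
  rwa [smul_smul, inv_mul_cancel₀ hr.ne', one_smul] at this


lemma vol_le_star [Nontrivial (EuclideanSpace ℝ (Fin n))]
    (hC_cone : ∀ x ∈ C, ∀ r : ℝ, 0 ≤ r → r • x ∈ C)
    (h : Metric.sphere (0 : EuclideanSpace ℝ (Fin n)) 1 → ℝ)
    (hh : ∀ u : Metric.sphere (0 : EuclideanSpace ℝ (Fin n)) 1,
      (u : EuclideanSpace ℝ (Fin n)) ∈ interior C → ∀ r : ℝ, 0 < r → h u ≤ r →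
        r • (u : EuclideanSpace ℝ (Fin n)) ∈ K) :
    volume (interior C \ K) ≤ volume (starSet h) := by
  have hsub : interior C \ K ⊆ starSet h ∪ {0} := by
    rintro x ⟨hx, hxK⟩
    by_cases hx0 : x = 0
    · exact Or.inr hx0
    left
    obtain ⟨u, r, hr, rfl⟩ := polar_mem hx0
    refine ⟨u, r, hr, ?_, rfl⟩
    by_contra hlt
    exact hxK (hh u ((int_smul_iff hC_cone hr).1 hx) r hr (not_lt.1 hlt))
  refine (measure_mono hsub).trans ((measure_union_le _ _).trans ?_)
  simp

lemma vol_eq_star [Nontrivial (EuclideanSpace ℝ (Fin n))] (hC_conv : Convex ℝ C)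
    (hC_cone : ∀ x ∈ C, ∀ r : ℝ, 0 ≤ r → r • x ∈ C)
    (hs : ∀ u : Metric.sphere (0 : EuclideanSpace ℝ (Fin n)) 1,
      (u : EuclideanSpace ℝ (Fin n)) ∈ interior C → 0 < rad C K u ∧
        ∀ r : ℝ, 0 < r → (r • (u : EuclideanSpace ℝ (Fin n)) ∈ K ↔ rad C K u ≤ r)) :
    volume (C \ K) = volume (starSet (rad C K)) := by
  rw [volume_diff_interior hC_conv]
  apply le_antisymm
  · exact vol_le_star hC_cone _ (fun u hu r hr h => ((hs u hu).2 r hr).2 h)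
  · apply measure_mono
    rintro _ ⟨u, r, hr, hru, rfl⟩
    by_cases hu : (u : EuclideanSpace ℝ (Fin n)) ∈ interior C
    · exact ⟨int_smul hC_cone hu hr, fun h => absurd (((hs u hu).2 r hr).1 h) (not_le.2 hru)⟩
    · rw [rad_out u hu] at hru
      linarith

lemma subset_of_ae {L : Set (EuclideanSpace ℝ (Fin n))}
    (hC_cone : ∀ x ∈ C, ∀ r : ℝ, 0 ≤ r → r • x ∈ C) (hC_int : (interior C).Nonempty)
    (hKC : K ⊆ C) (hKclosed : IsClosed K) (hKconv : Convex ℝ K) (hLclosed : IsClosed L)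
    (hne : K.Nonempty) (h0 : (0 : EuclideanSpace ℝ (Fin n)) ∉ K)
    (hadd : ∀ x ∈ K, ∀ c ∈ C, x + c ∈ K)
    (hs : ∀ u : Metric.sphere (0 : EuclideanSpace ℝ (Fin n)) 1,
      (u : EuclideanSpace ℝ (Fin n)) ∈ interior C → 0 < rad C K u ∧
        ∀ r : ℝ, 0 < r → (r • (u : EuclideanSpace ℝ (Fin n)) ∈ K ↔ rad C K u ≤ r))
    (hsL : ∀ u : Metric.sphere (0 : EuclideanSpace ℝ (Fin n)) 1,
      (u : EuclideanSpace ℝ (Fin n)) ∈ interior C → 0 < rad C L u ∧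
        ∀ r : ℝ, 0 < r → (r • (u : EuclideanSpace ℝ (Fin n)) ∈ L ↔ rad C L u ≤ r))
    (α : ℝ) (hα : 0 < α)
    (hae : ∀ᵐ u ∂(volume : Measure (EuclideanSpace ℝ (Fin n))).toSphere,
      rad C K u = α * rad C L u) : K ⊆ α • L := by
  have hLc : IsClosed (α • L) := hLclosed.smul₀ _
  have hint : (interior K).Nonempty := by
    obtain ⟨x, hx⟩ := hne
    obtain ⟨c, hc⟩ := hC_int
    have hsub : (x +ᵥ interior C) ⊆ interior K := by
      apply interior_maximal _ (isOpen_interior.vadd x)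
      rintro _ ⟨y, hy, rfl⟩
      exact hadd x hx y (interior_subset hy)
    exact ⟨x + c, hsub ⟨c, hc, rfl⟩⟩
  have hcl : closure (interior K) = K := by
    rw [hKconv.closure_interior_eq_closure_of_nonempty_interior hint, hKclosed.closure_eq]
  rw [← hcl]
  refine closure_minimal ?_ hLc
  intro x hx
  by_contra hxL
  have hx0 : x ≠ 0 := by
    rintro rfl
    exact h0 (interior_subset hx)
  obtain ⟨u, t, ht, rfl⟩ := polar_mem hx0
  have hcont : Continuous fun v : Metric.sphere (0 : EuclideanSpace ℝ (Fin n)) 1 =>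
    t • (v : EuclideanSpace ℝ (Fin n)) := by fun_prop
  have hO : IsOpen ((fun v : Metric.sphere (0 : EuclideanSpace ℝ (Fin n)) 1 =>
      t • (v : EuclideanSpace ℝ (Fin n))) ⁻¹' (interior K ∩ (α • L)ᶜ)) :=
    (isOpen_interior.inter hLc.isOpen_compl).preimage hcont
  have hpos := hO.measure_pos (volume : Measure (EuclideanSpace ℝ (Fin n))).toSphere
    ⟨u, hx, hxL⟩
  obtain ⟨v, ⟨hv1, hv2⟩, hv⟩ : ∃ v, v ∈ ((fun v : Metric.sphere (0 : EuclideanSpace ℝ (Fin n)) 1 =>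
      t • (v : EuclideanSpace ℝ (Fin n))) ⁻¹' (interior K ∩ (α • L)ᶜ)) ∧
      rad C K v = α * rad C L v := by
    by_contra hcon
    push Not at hcon
    have := measure_mono_null (s := (fun v : Metric.sphere (0 : EuclideanSpace ℝ (Fin n)) 1 =>
      t • (v : EuclideanSpace ℝ (Fin n))) ⁻¹' (interior K ∩ (α • L)ᶜ)) hcon (ae_iff.1 hae)
    exact hpos.ne' this
  have hvC : (v : EuclideanSpace ℝ (Fin n)) ∈ interior C :=
    (int_smul_iff hC_cone ht).1 (interior_mono hKC hv1)
  have h1 := ((hs v hvC).2 t ht).1 (interior_subset hv1)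
  have h2 : rad C L v ≤ α⁻¹ * t := by
    rw [hv] at h1
    rwa [le_inv_mul_iff₀ hα]
  have h3 := ((hsL v hvC).2 (α⁻¹ * t) (by positivity)).2 h2
  apply hv2
  refine ⟨_, h3, ?_⟩
  simp only [smul_smul]
  rw [mul_inv_cancel_left₀ hα.ne']

end

lemma sphere_one_dim (u v : EuclideanSpace ℝ (Fin 1)) (hu : ‖u‖ = 1) (hv : ‖v‖ = 1) :
    u = v ∨ u = -v := by
  rw [EuclideanSpace.norm_eq] at hu hv
  simp at hu hv
  have h : |u 0| = |v 0| := by rcases hu with hu | hu <;> rcases hv with hv | hv <;> simp [hu, hv]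
  rcases abs_eq_abs.1 h with h | h
  · left
    ext i
    fin_cases i
    exact h
  · right
    ext i
    fin_cases i
    exact h

/-- integral part: equality forces proportional radial functions (dimension at least two). -/
lemma ae_prop {Ω : Type*} [MeasurableSpace Ω] (σ : Measure Ω) {n : ℕ} (hn : 2 ≤ n)
    (p q : Ω → ℝ) (hpm : Measurable p) (hqm : Measurable q) (hp : ∀ u, 0 ≤ p u)
    (hq : ∀ u, 0 ≤ q u) (a b l : ℝ) (ha : 0 < a) (hb : 0 < b) (hl0 : 0 < l) (hl1 : l < 1)
    (hpa : ∫⁻ u, ENNReal.ofReal (p u ^ n / n) ∂σ = ENNReal.ofReal (a ^ n))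
    (hqb : ∫⁻ u, ENNReal.ofReal (q u ^ n / n) ∂σ = ENNReal.ofReal (b ^ n))
    (hle : ENNReal.ofReal (((1 - l) * a + l * b) ^ n) ≤
      ∫⁻ u, ENNReal.ofReal (((1 - l) * p u + l * q u) ^ n / n) ∂σ) :
    ∀ᵐ u ∂σ, p u = (a / b) * q u := by
  have hl : 0 < 1 - l := by linarith
  have hn0 : (0 : ℝ) < n := by exact_mod_cast (by omega : 0 < n)
  set s := (1 - l) * a + l * b with hs
  have hspos : 0 < s := by positivity
  set c1 : ℝ := s ^ n * ((1 - l) * a / s) / a ^ n with hc1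
  set c2 : ℝ := s ^ n * (l * b / s) / b ^ n with hc2
  have hc1p : 0 < c1 := by positivity
  have hc2p : 0 < c2 := by positivity
  set G : Ω → ℝ := fun u => c1 * (p u ^ n / n) + c2 * (q u ^ n / n) with hG
  have hGeq : ∀ u, G u = s ^ n * (((1 - l) * a / s) * (p u / a) ^ n
        + (l * b / s) * (q u / b) ^ n) / n := by
    intro u
    simp only [hG, hc1, hc2, div_pow]
    field_simp
  have hGint : ∫⁻ u, ENNReal.ofReal (G u) ∂σ = ENNReal.ofReal (s ^ n) := by
    have : ∀ u, ENNReal.ofReal (G u) = ENNReal.ofReal c1 * ENNReal.ofReal (p u ^ n / n)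
        + ENNReal.ofReal c2 * ENNReal.ofReal (q u ^ n / n) := by
      intro u
      have := hp u
      have := hq u
      rw [hG, ← ENNReal.ofReal_mul hc1p.le, ← ENNReal.ofReal_mul hc2p.le,
        ← ENNReal.ofReal_add (by positivity) (by positivity)]
    simp_rw [this]
    rw [lintegral_add_left (by fun_prop), lintegral_const_mul _ (by fun_prop),
      lintegral_const_mul _ (by fun_prop), hpa, hqb, ← ENNReal.ofReal_mul hc1p.le,
      ← ENNReal.ofReal_mul hc2p.le, ← ENNReal.ofReal_add (by positivity) (by positivity)]
    congr 1
    have e1 : c1 * a ^ n = s ^ n * ((1 - l) * a / s) := by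
      rw [hc1]; field_simp
    have e2 : c2 * b ^ n = s ^ n * (l * b / s) := by
      rw [hc2]; field_simp
    rw [e1, e2, ← mul_add, ← add_div, ← hs, div_self hspos.ne', mul_one]
  have hpt : ∀ u, ((1 - l) * p u + l * q u) ^ n / n ≤ G u := by
    intro u
    rw [hGeq]
    gcongr
    exact (real_conv hn (hp u) (hq u) ha hb hl0 hl1).1
  have hae := ae_eq_of_ae_le_of_lintegral_le (μ := σ)
    (f := fun u => ENNReal.ofReal (((1 - l) * p u + l * q u) ^ n / n))
    (g := fun u => ENNReal.ofReal (G u))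
    (Filter.Eventually.of_forall fun u => ENNReal.ofReal_le_ofReal (hpt u))
    (ne_top_of_le_ne_top (hGint ▸ ENNReal.ofReal_ne_top)
      (lintegral_mono fun u => ENNReal.ofReal_le_ofReal (hpt u)))
    (by fun_prop) (hGint ▸ hle)
  filter_upwards [hae] with u hu
  have hpu := hp u
  have hqu := hq u
  have h0 : 0 ≤ ((1 - l) * p u + l * q u) ^ n / n := by positivity
  rw [ENNReal.ofReal_eq_ofReal_iff h0 (h0.trans (hpt u)), hGeq, div_left_inj' hn0.ne'] at hu
  have := (real_conv hn hpu hqu ha hb hl0 hl1).2 hu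
  field_simp at this ⊢
  linarith

/-- Equality case of the complemented Brunn–Minkowski inequality: if equality holds
for some `λ ∈ (0,1)`, then `A₀ = α • A₁` for some `α > 0`. -/
theorem coconvex_brunn_minkowski_eq_case {n : ℕ}
    (C K₀ K₁ : Set (EuclideanSpace ℝ (Fin n)))
    (hC_closed : IsClosed C) (hC_conv : Convex ℝ C)
    (hC_cone : ∀ x ∈ C, ∀ r : ℝ, 0 ≤ r → r • x ∈ C)
    (hC_pointed : C ∩ (-C) = {0})
    (hC_int : (interior C).Nonempty)
    (hK₀C : K₀ ⊆ C) (hK₀closed : IsClosed K₀) (hK₀conv : Convex ℝ K₀)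
    (hK₁C : K₁ ⊆ C) (hK₁closed : IsClosed K₁) (hK₁conv : Convex ℝ K₁)
    (hA₀pos : 0 < volume (C \ K₀)) (hA₀fin : volume (C \ K₀) < ⊤)
    (hA₁pos : 0 < volume (C \ K₁)) (hA₁fin : volume (C \ K₁) < ⊤)
    (l : ℝ) (hl0 : 0 < l) (hl1 : l < 1)
    (heq : (volume (C \ ((1 - l) • K₀ + l • K₁))) ^ ((1 : ℝ) / n) =
      ENNReal.ofReal (1 - l) * (volume (C \ K₀)) ^ ((1 : ℝ) / n) +
        ENNReal.ofReal l * (volume (C \ K₁)) ^ ((1 : ℝ) / n)) :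
    ∃ α : ℝ, 0 < α ∧ C \ K₀ = α • (C \ K₁) := by
  rcases Nat.eq_zero_or_pos n with hn | hn
  · subst hn
    refine ⟨1, one_pos, ?_⟩
    have hC0 : C = {0} := by
      ext x
      have : x = 0 := Subsingleton.elim _ _
      obtain ⟨y, hy⟩ := hC_int
      have hy0 : y = 0 := Subsingleton.elim _ _
      subst this
      simpa using hy0 ▸ interior_subset hy
    have key : ∀ K : Set (EuclideanSpace ℝ (Fin 0)), 0 < volume (C \ K) → C \ K = C := by
      intro K hK
      have hne : (C \ K).Nonempty := nonempty_of_measure_ne_zero hK.ne'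
      obtain ⟨y, hy⟩ := hne
      ext x
      have : x = y := Subsingleton.elim _ _
      subst this
      simp [hy.1, hy.2]
    rw [key _ hA₀pos, key _ hA₁pos, one_smul]
  have hn' : n ≠ 0 := hn.ne'
  haveI : Nonempty (Fin n) := ⟨⟨0, hn⟩⟩
  haveI : Nontrivial (EuclideanSpace ℝ (Fin n)) := inferInstance
  have hl : 0 < 1 - l := by linarith
  have hne₀ := K_nonempty hn' hC_cone hC_int hA₀fin
  have hne₁ := K_nonempty hn' hC_cone hC_int hA₁fin
  have hadd₀ : ∀ x ∈ K₀, ∀ c ∈ C, x + c ∈ K₀ := fun x hx c hc =>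
    K_add hn' hC_closed hC_conv hC_cone hC_int hK₀C hK₀closed hK₀conv hA₀fin hx hc
  have hadd₁ : ∀ x ∈ K₁, ∀ c ∈ C, x + c ∈ K₁ := fun x hx c hc =>
    K_add hn' hC_closed hC_conv hC_cone hC_int hK₁C hK₁closed hK₁conv hA₁fin hx hc
  have hzero : ∀ K : Set (EuclideanSpace ℝ (Fin n)), (∀ x ∈ K, ∀ c ∈ C, x + c ∈ K) →
      0 < volume (C \ K) → (0 : EuclideanSpace ℝ (Fin n)) ∉ K := by
    intro K hadd hpos h0
    obtain ⟨y, hy⟩ := nonempty_of_measure_ne_zero hpos.ne'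
    exact hy.2 (by simpa using hadd 0 h0 y hy.1)
  have h0₀ := hzero K₀ hadd₀ hA₀pos
  have h0₁ := hzero K₁ hadd₁ hA₁pos
  have hs₀ := rad_spec hC_cone hne₀ hK₀closed h0₀ hadd₀
  have hs₁ := rad_spec hC_cone hne₁ hK₁closed h0₁ hadd₁
  have hnn : ∀ K : Set (EuclideanSpace ℝ (Fin n)),
      (∀ u : Metric.sphere (0 : EuclideanSpace ℝ (Fin n)) 1,
        (u : EuclideanSpace ℝ (Fin n)) ∈ interior C → 0 < rad C K u ∧
        ∀ r : ℝ, 0 < r → (r • (u : EuclideanSpace ℝ (Fin n)) ∈ K ↔ rad C K u ≤ r)) →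
      ∀ u, 0 ≤ rad C K u := by
    intro K hs u
    by_cases hu : (u : EuclideanSpace ℝ (Fin n)) ∈ interior C
    · exact (hs u hu).1.le
    · rw [rad_out u hu]
  have hr₀ := hnn K₀ hs₀
  have hr₁ := hnn K₁ hs₁
  have hm₀ := rad_measurable hK₀closed hs₀
  have hm₁ := rad_measurable hK₁closed hs₁
  have hv₀ := vol_eq_star hC_conv hC_cone hs₀
  have hv₁ := vol_eq_star hC_conv hC_cone hs₁
  rw [volume_starSet _ _ hm₀ hr₀, finrank_euclideanSpace_fin] at hv₀
  rw [volume_starSet _ _ hm₁ hr₁, finrank_euclideanSpace_fin] at hv₁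
  obtain ⟨α, hα, hae⟩ : ∃ α : ℝ, 0 < α ∧
      ∀ᵐ u ∂(volume : Measure (EuclideanSpace ℝ (Fin n))).toSphere,
        rad C K₀ u = α * rad C K₁ u := by
    by_cases h1 : n = 1
    · subst h1
      obtain ⟨y, hy⟩ := hC_int
      by_cases hex : ∃ u : Metric.sphere (0 : EuclideanSpace ℝ (Fin 1)) 1,
        (u : EuclideanSpace ℝ (Fin 1)) ∈ interior C
      · obtain ⟨u, hu⟩ := hex
        refine ⟨rad C K₀ u / rad C K₁ u, div_pos (hs₀ u hu).1 (hs₁ u hu).1, ?_⟩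
        refine Filter.Eventually.of_forall fun v => ?_
        by_cases hv : (v : EuclideanSpace ℝ (Fin 1)) ∈ interior C
        · have huv : v = u := by
            rcases sphere_one_dim v u (by simpa using v.2) (by simpa using u.2) with h | h
            · exact Subtype.ext h
            · exfalso
              have h2 : (u : EuclideanSpace ℝ (Fin 1)) ∈ C ∩ (-C) :=
                ⟨interior_subset hu, by
                  rw [Set.mem_neg, ← h]; exact interior_subset hv⟩
              rw [hC_pointed] at h2
              have h3 : ‖(u : EuclideanSpace ℝ (Fin 1))‖ = 1 := by simpa using u.2
              rw [mem_singleton_iff.1 h2, norm_zero] at h3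
              exact zero_ne_one h3
          rw [huv, div_mul_cancel₀ _ (hs₁ u hu).1.ne']
        · rw [rad_out v hv, rad_out v hv, mul_zero]
      · push Not at hex
        refine ⟨1, one_pos, Filter.Eventually.of_forall fun v => ?_⟩
        rw [rad_out v (hex v), rad_out v (hex v), mul_zero]
    · have hn2 : 2 ≤ n := by omega
      have hroot : ∀ V : ENNReal, 0 < V → V < ⊤ → ∃ a : ℝ, 0 < a ∧
          V ^ ((1 : ℝ) / n) = ENNReal.ofReal a ∧ V = ENNReal.ofReal (a ^ n) := by
        intro V hV0 hVt
        have hp := ENNReal.toReal_pos hV0.ne' hVt.ne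
        refine ⟨V.toReal ^ ((1 : ℝ) / n), by positivity, ?_, ?_⟩
        · rw [← ENNReal.ofReal_rpow_of_pos hp, ENNReal.ofReal_toReal hVt.ne]
        · rw [one_div, Real.rpow_inv_natCast_pow hp.le hn', ENNReal.ofReal_toReal hVt.ne]
      obtain ⟨a, ha, ha1, ha2⟩ := hroot _ hA₀pos hA₀fin
      obtain ⟨b, hb, hb1, hb2⟩ := hroot _ hA₁pos hA₁fin
      have hV : volume (C \ ((1 - l) • K₀ + l • K₁)) =
          ENNReal.ofReal (((1 - l) * a + l * b) ^ n) := by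
        rw [ha1, hb1, ← ENNReal.ofReal_mul hl.le, ← ENNReal.ofReal_mul hl0.le,
          ← ENNReal.ofReal_add (by positivity) (by positivity)] at heq
        rw [ENNReal.ofReal_pow (by positivity), ← heq, one_div, ← ENNReal.rpow_natCast,
          ENNReal.rpow_inv_rpow (by exact_mod_cast hn')]
      refine ⟨a / b, div_pos ha hb, ?_⟩
      refine ae_prop _ hn2 _ _ hm₀ hm₁ hr₀ hr₁ a b l ha hb hl0 hl1 (hv₀ ▸ ha2) (hv₁ ▸ hb2) ?_
      have hst := volume_starSet (volume : Measure (EuclideanSpace ℝ (Fin n)))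
        (fun u => (1 - l) * rad C K₀ u + l * rad C K₁ u) (by fun_prop)
        (fun u => add_nonneg (mul_nonneg hl.le (hr₀ u)) (mul_nonneg hl0.le (hr₁ u)))
      rw [finrank_euclideanSpace_fin] at hst
      rw [← hst, ← hV, volume_diff_interior hC_conv]
      apply vol_le_star hC_cone
      intro u hu r hr hle
      obtain ⟨hp0, hk0⟩ := hs₀ u hu
      obtain ⟨hp1, hk1⟩ := hs₁ u hu
      set h := (1 - l) * rad C K₀ u + l * rad C K₁ u with hh
      have hpos : 0 < h := by positivity
      have hq : 1 ≤ r / h := (one_le_div hpos).2 hle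
      refine ⟨(1 - l) • ((r / h * rad C K₀ u) • (u : EuclideanSpace ℝ (Fin n))),
        smul_mem_smul_set ((hk0 _ (by positivity)).2 (le_mul_of_one_le_left hp0.le hq)),
        l • ((r / h * rad C K₁ u) • (u : EuclideanSpace ℝ (Fin n))),
        smul_mem_smul_set ((hk1 _ (by positivity)).2 (le_mul_of_one_le_left hp1.le hq)), ?_⟩
      simp only [smul_smul, ← add_smul]
      congr 1
      have : (1 - l) * (r / h * rad C K₀ u) + l * (r / h * rad C K₁ u) = r / h * h := by
        rw [hh]; ring
      rw [this, div_mul_cancel₀ _ hpos.ne']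
  refine ⟨α, hα, ?_⟩
  have hsub1 : K₀ ⊆ α • K₁ := subset_of_ae hC_cone hC_int hK₀C hK₀closed hK₀conv hK₁closed hne₀
    h0₀ hadd₀ hs₀ hs₁ α hα hae
  have hsub2 : K₁ ⊆ α⁻¹ • K₀ := subset_of_ae hC_cone hC_int hK₁C hK₁closed hK₁conv hK₀closed hne₁
    h0₁ hadd₁ hs₁ hs₀ α⁻¹ (inv_pos.2 hα) (by
      filter_upwards [hae] with u hu
      rw [hu, inv_mul_cancel_left₀ hα.ne'])
  have hK : K₀ = α • K₁ := by
    apply hsub1.antisymm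
    have := smul_set_mono (a := α) hsub2
    rwa [smul_inv_smul₀ hα.ne'] at this
  have hCα : α • C = C := by
    apply Subset.antisymm
    · rintro _ ⟨x, hx, rfl⟩
      exact hC_cone x hx α hα.le
    · intro x hx
      exact ⟨α⁻¹ • x, hC_cone x hx _ (inv_pos.2 hα).le, smul_inv_smul₀ hα.ne' x⟩
  rw [smul_set_sdiff₀ hα.ne', hCα, ← hK]
end

section
/- Let $C \subset \mathbb{R}^n$ ($n \ge 2$) be a pointed closed convex cone with nonempty interior. If $K_0, K_1$ are $C$-close sets whose surface area measures on $\Omega_C$ coincide, i.e., $S_{n-1}(K_0, \cdot) = S_{n-1}(K_1, \cdot)$ as Borel measures on $\Omega_C = \mathbb{S}^{n-1} \cap \mathrm{int}\,C^\circ$, then $K_0 = K_1$. -/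
open Set Pointwise MeasureTheory RealInnerProductSpace

/-- `u` is an outer unit normal vector of `K` at the boundary point `x`. -/
def IsOuterNormal {n : ℕ} (K : Set (EuclideanSpace ℝ (Fin n)))
    (x u : EuclideanSpace ℝ (Fin n)) : Prop :=
  ‖u‖ = 1 ∧ ∀ y ∈ K, ⟪y, u⟫ ≤ ⟪x, u⟫

/-- The reverse spherical image of `K` at `ω`: boundary points of `K` admitting an
outer unit normal in `ω`. -/
def revSphImage {n : ℕ} (K ω : Set (EuclideanSpace ℝ (Fin n))) :
    Set (EuclideanSpace ℝ (Fin n)) :=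
  {x ∈ frontier K | ∃ u ∈ ω, IsOuterNormal K x u}


/-- `K` is a `C`-close set, `C` a closed convex cone with interior points. -/
structure CClose {n : ℕ} (C K : Set (EuclideanSpace ℝ (Fin n))) : Prop where
  C_closed : IsClosed C
  C_conv : Convex ℝ C
  C_cone : ∀ x ∈ C, ∀ r : ℝ, 0 ≤ r → r • x ∈ C
  C_int : (interior C).Nonempty
  K_sub : K ⊆ C
  K_closed : IsClosed K
  K_conv : Convex ℝ K
  vol_pos : 0 < volume (C \ K)
  vol_fin : volume (C \ K) < ⊤
  dim : 2 ≤ n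

/-- The antipolar set of `K`. -/
def antiP {n : ℕ} (K : Set (EuclideanSpace ℝ (Fin n))) : Set (EuclideanSpace ℝ (Fin n)) :=
  {p | ∀ z ∈ K, 1 ≤ ⟪z, p⟫}

namespace CClose

variable {n : ℕ} {C K : Set (EuclideanSpace ℝ (Fin n))}

lemma add_mem (h : CClose C K) {x y : EuclideanSpace ℝ (Fin n)} (hx : x ∈ C) (hy : y ∈ C) :
    x + y ∈ C := by
  have := h.C_conv hx hy (a := 1/2) (b := 1/2) (by norm_num) (by norm_num) (by norm_num)
  have h2 := h.C_cone _ this 2 (by norm_num)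
  simpa [smul_add, smul_smul] using h2

lemma add_mem_interior (h : CClose C K) {x y : EuclideanSpace ℝ (Fin n)}
    (hx : x ∈ interior C) (hy : y ∈ C) : x + y ∈ interior C := by
  rw [mem_interior_iff_mem_nhds, Metric.mem_nhds_iff] at hx ⊢
  obtain ⟨r, hr, hb⟩ := hx
  refine ⟨r, hr, fun z hz => ?_⟩
  have : z - y ∈ C := hb (by
    rw [Metric.mem_ball, dist_eq_norm] at hz ⊢
    have e : z - y - x = z - (x + y) := by abel
    rwa [e])
  simpa using h.add_mem this hy

lemma smul_mem_interior (h : CClose C K) {x : EuclideanSpace ℝ (Fin n)}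
    (hx : x ∈ interior C) {t : ℝ} (ht : 0 < t) : t • x ∈ interior C := by
  have h1 : t • x ∈ t • interior C := smul_mem_smul_set hx
  rw [← interior_smul₀ ht.ne'] at h1
  refine interior_mono ?_ h1
  rintro _ ⟨y, hy, rfl⟩
  exact h.C_cone y hy t ht.le

lemma vol_top (h : CClose C K) {z v c : EuclideanSpace ℝ (Fin n)} {b : ℝ}
    (hz : z ∈ interior C) (hzb : ⟪z, v⟫ < b) (hc : c ∈ C) (hc0 : c ≠ 0) (hcv : ⟪c, v⟫ ≤ 0) :
    volume (C ∩ {x | ⟪x, v⟫ < b}) = ⊤ := by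
  have hop : IsOpen (interior C ∩ {x | ⟪x, v⟫ < b}) :=
    isOpen_interior.inter (isOpen_lt (by fun_prop) continuous_const)
  obtain ⟨r, hr, hb⟩ := Metric.isOpen_iff.1 hop z ⟨hz, hzb⟩
  have hcn : 0 < ‖c‖ := norm_pos_iff.2 hc0
  set L : ℝ := 2 * r / ‖c‖ with hL
  have hLp : 0 < L := by positivity
  let f : ℕ → EuclideanSpace ℝ (Fin n) := fun k => z + ((k : ℝ) * L) • c
  have hsub : (⋃ k, Metric.ball (f k) r) ⊆ C ∩ {x | ⟪x, v⟫ < b} := by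
    refine iUnion_subset fun k x hx => ?_
    have hk : 0 ≤ (k : ℝ) * L := by positivity
    have hx' : x - ((k : ℝ) * L) • c ∈ Metric.ball z r := by
      rw [Metric.mem_ball, dist_eq_norm] at hx ⊢
      have e : x - ((k : ℝ) * L) • c - z = x - f k := by simp only [f]; abel
      rwa [e]
    obtain ⟨h1, h2⟩ := hb hx'
    constructor
    · simpa using h.add_mem (interior_subset h1) (h.C_cone c hc _ hk)
    · simp only [mem_ofPred_eq, inner_sub_left, inner_smul_left] at h2 ⊢
      have : (k : ℝ) * L * ⟪c, v⟫ ≤ 0 := mul_nonpos_of_nonneg_of_nonpos hk hcv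
      simp at h2
      linarith
  have hdisj : Pairwise (Function.onFun Disjoint fun k => Metric.ball (f k) r) := by
    intro i j hij
    apply Metric.ball_disjoint_ball
    have : dist (f i) (f j) = |(i : ℝ) - j| * (2 * r) := by
      rw [dist_eq_norm]
      have e : f i - f j = (((i : ℝ) - j) * L) • c := by
        simp only [f, sub_mul, sub_smul]; abel
      rw [e, norm_smul, Real.norm_eq_abs, abs_mul, abs_of_pos hLp, mul_assoc, hL,
        div_mul_cancel₀ _ hcn.ne']
    rw [this]
    have h1 : (1 : ℝ) ≤ |(i : ℝ) - j| := by
      have : (1 : ℤ) ≤ |(i : ℤ) - j| := Int.one_le_abs (by omega)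
      exact_mod_cast this
    nlinarith
  refine top_unique (le_trans ?_ (measure_mono hsub))
  rw [measure_iUnion hdisj fun k => Metric.isOpen_ball.measurableSet]
  have : ∀ k, volume (Metric.ball (f k) r) = volume (Metric.ball (0 : EuclideanSpace ℝ (Fin n)) r) :=
    fun k => Measure.addHaar_ball_center _ _ _
  simp only [this]
  rw [ENNReal.tsum_const_eq_top_of_ne_zero (Metric.measure_ball_pos _ _ hr).ne']

lemma inner_pos_of_antiP (h : CClose C K) {p c : EuclideanSpace ℝ (Fin n)} (hp : p ∈ antiP K)
    (hc : c ∈ C) (hc0 : c ≠ 0) : 0 < ⟪c, p⟫ := by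
  by_contra hcon
  push Not at hcon
  obtain ⟨z0, hz0⟩ := h.C_int
  have : ∃ z ∈ interior C, ⟪z, p⟫ < 1 := by
    refine ⟨(1 / (1 + |⟪z0, p⟫|)) • z0, h.smul_mem_interior hz0 (by positivity), ?_⟩
    rw [inner_smul_left]
    simp only [conj_trivial]
    rw [div_mul_eq_mul_div, div_lt_one (by positivity)]
    linarith [le_abs_self ⟪z0, p⟫]
  obtain ⟨z, hz, hz1⟩ := this
  have h1 := h.vol_top hz hz1 hc hc0 hcon
  have h2 : C ∩ {x | ⟪x, p⟫ < 1} ⊆ C \ K := fun x hx => ⟨hx.1, fun hk => by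
    have := hp x hk
    have := hx.2
    simp only [mem_ofPred_eq] at this
    linarith⟩
  have := measure_mono (μ := volume) h2
  rw [h1] at this
  exact absurd h.vol_fin (by simpa using this)

lemma nontriv (h : CClose C K) : Nontrivial (EuclideanSpace ℝ (Fin n)) := by
  have : Nonempty (Fin n) := ⟨⟨0, by have := h.dim; omega⟩⟩
  infer_instance

lemma exists_ne (h : CClose C K) : ∃ c ∈ C, c ≠ 0 := by
  by_contra hcon
  push Not at hcon
  have := h.vol_pos
  have hs : C \ K ⊆ {0} := fun x hx => hcon x hx.1
  have := h.nontriv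
  have h2 := measure_mono (μ := volume) hs
  simp at h2
  exact absurd h.vol_pos (by simp [h2])

lemma K_nonempty (h : CClose C K) : K.Nonempty := by
  by_contra hcon
  rw [not_nonempty_iff_eq_empty] at hcon
  obtain ⟨c, hc, hc0⟩ := h.exists_ne
  have := h.inner_pos_of_antiP (p := 0) (by simp [antiP, hcon]) hc hc0
  simp at this

lemma exists_sep (h : CClose C K) {x : EuclideanSpace ℝ (Fin n)} (hx : x ∈ C) (hxK : x ∉ K) :
    ∃ p ∈ antiP K, ⟪x, p⟫ < 1 := by
  obtain ⟨f, b, hfx, hfK⟩ := geometric_hahn_banach_point_closed h.K_conv h.K_closed hxK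
  obtain ⟨v, rfl⟩ := (InnerProductSpace.toDual ℝ (EuclideanSpace ℝ (Fin n))).surjective f
  simp only [InnerProductSpace.toDual_apply_apply] at hfx hfK
  have hv : ∀ c ∈ C, 0 ≤ ⟪c, v⟫ := by
    intro c hc
    by_contra hcon
    push Not at hcon
    obtain ⟨z0, hz0⟩ := h.C_int
    have hc0 : c ≠ 0 := by rintro rfl; simp at hcon
    obtain ⟨t, ht⟩ : ∃ t : ℝ, 0 ≤ t ∧ ⟪z0, v⟫ + t * ⟪c, v⟫ < b := by
      refine ⟨(|⟪z0, v⟫ - b| + 1) / (-⟪c, v⟫), div_nonneg (by positivity) (by linarith), ?_⟩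
      have : (|⟪z0, v⟫ - b| + 1) / (-⟪c, v⟫) * ⟪c, v⟫ = -(|⟪z0, v⟫ - b| + 1) := by
        rw [div_neg, neg_mul, div_mul_cancel₀ _ hcon.ne]
      rw [this]
      linarith [le_abs_self (⟪z0, v⟫ - b)]
    have h1 := h.vol_top (z := z0 + t • c) (v := v) (b := b)
      (h.add_mem_interior hz0 (h.C_cone c hc t ht.1))
      (by rw [inner_add_left, inner_smul_left]; simpa using ht.2) hc hc0 hcon.le
    have h2 : C ∩ {x | ⟪x, v⟫ < b} ⊆ C \ K := fun x hx => ⟨hx.1, fun hk => by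
      have := hfK x hk
      have h3 := hx.2
      simp only [mem_ofPred_eq] at h3
      rw [real_inner_comm] at h3
      linarith⟩
    have := measure_mono (μ := volume) h2
    rw [h1] at this
    exact absurd h.vol_fin (by simpa using this)
  have hb : 0 < b := by
    have := hv x hx
    rw [real_inner_comm] at this
    linarith
  refine ⟨b⁻¹ • v, fun z hz => ?_, ?_⟩
  · rw [inner_smul_right, real_inner_comm, ← div_eq_inv_mul, le_div_iff₀ hb]
    linarith [hfK z hz]
  · rw [inner_smul_right, real_inner_comm, ← div_eq_inv_mul, div_lt_one hb]
    exact hfx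

lemma antiP_nonempty (h : CClose C K) : (antiP K).Nonempty := by
  have : (C \ K).Nonempty := by
    by_contra hcon
    rw [not_nonempty_iff_eq_empty] at hcon
    have := h.vol_pos
    simp [hcon] at this
  obtain ⟨x, hx⟩ := this
  obtain ⟨p, hp, _⟩ := h.exists_sep hx.1 hx.2
  exact ⟨p, hp⟩

lemma zero_notMem (h : CClose C K) : (0 : EuclideanSpace ℝ (Fin n)) ∉ K := by
  intro h0
  obtain ⟨p, hp⟩ := h.antiP_nonempty
  have := hp 0 h0
  simp at this
  linarith

lemma inner_nonneg_of_antiP (h : CClose C K) {p c : EuclideanSpace ℝ (Fin n)} (hp : p ∈ antiP K)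
    (hc : c ∈ C) : 0 ≤ ⟪c, p⟫ := by
  by_cases hc0 : c = 0
  · simp [hc0]
  · exact (h.inner_pos_of_antiP hp hc hc0).le

lemma antiP_closed : IsClosed (antiP K) := by
  have : antiP K = ⋂ z ∈ K, {p | 1 ≤ ⟪z, p⟫} := by ext; simp [antiP]
  rw [this]
  exact isClosed_biInter fun z _ => isClosed_le continuous_const (by fun_prop)

lemma antiP_ne_zero (h : CClose C K) {p : EuclideanSpace ℝ (Fin n)} (hp : p ∈ antiP K) :
    p ≠ 0 := by
  rintro rfl
  obtain ⟨z, hz⟩ := h.K_nonempty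
  have := hp z hz
  simp at this
  linarith

lemma zero_notMem_interior (h : CClose C K) : (0 : EuclideanSpace ℝ (Fin n)) ∉ interior C := by
  intro h0
  obtain ⟨p, hp⟩ := h.antiP_nonempty
  have hp0 := h.antiP_ne_zero hp
  rw [mem_interior_iff_mem_nhds, Metric.mem_nhds_iff] at h0
  obtain ⟨r, hr, hb⟩ := h0
  have hpn : 0 < ‖p‖ := norm_pos_iff.2 hp0
  have hm : (-(r / (2 * ‖p‖))) • p ∈ C := hb (by
    rw [Metric.mem_ball, dist_zero_right, norm_smul, norm_neg, Real.norm_of_nonneg (by positivity)]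
    have : r / (2 * ‖p‖) * ‖p‖ = r / 2 := by field_simp
    rw [this]; linarith)
  have := h.inner_nonneg_of_antiP hp hm
  rw [inner_smul_left, real_inner_self_eq_norm_sq] at this
  simp only [conj_trivial] at this
  have h3 : 0 < (r / (2 * ‖p‖)) * ‖p‖^2 := by positivity
  linarith

/-- coercivity over the antipolar set at interior points -/
lemma antiP_coercive (h : CClose C K) {x : EuclideanSpace ℝ (Fin n)} (hx : x ∈ interior C) :
    ∃ c > 0, ∀ p ∈ antiP K, c * ‖p‖ ≤ ⟪x, p⟫ := by
  rw [mem_interior_iff_mem_nhds, Metric.mem_nhds_iff] at hx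
  obtain ⟨r, hr, hb⟩ := hx
  refine ⟨r / 2, by positivity, fun p hp => ?_⟩
  have hpn : 0 < ‖p‖ := norm_pos_iff.2 (h.antiP_ne_zero hp)
  have hm : x - (r / (2 * ‖p‖)) • p ∈ C := hb (by
    rw [Metric.mem_ball, dist_eq_norm, sub_sub_cancel_left, norm_neg, norm_smul,
      Real.norm_of_nonneg (by positivity)]
    have : r / (2 * ‖p‖) * ‖p‖ = r / 2 := by field_simp
    rw [this]; linarith)
  have := h.inner_nonneg_of_antiP hp hm
  rw [inner_sub_left, inner_smul_left, real_inner_self_eq_norm_sq] at this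
  simp only [conj_trivial] at this
  have h3 : (r / (2 * ‖p‖)) * ‖p‖^2 = r / 2 * ‖p‖ := by field_simp
  linarith

lemma exists_min (h : CClose C K) {x : EuclideanSpace ℝ (Fin n)} (hx : x ∈ interior C) :
    ∃ p ∈ antiP K, ∀ q ∈ antiP K, ⟪x, p⟫ ≤ ⟪x, q⟫ := by
  obtain ⟨c, hc, hco⟩ := h.antiP_coercive hx
  obtain ⟨p0, hp0⟩ := h.antiP_nonempty
  set R := ⟪x, p0⟫ / c with hR
  have hcomp : IsCompact (antiP K ∩ Metric.closedBall 0 R) :=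
    (isCompact_closedBall _ _).inter_left antiP_closed
  have hp0m : p0 ∈ antiP K ∩ Metric.closedBall 0 R := by
    refine ⟨hp0, ?_⟩
    rw [mem_closedBall_zero_iff, hR, le_div_iff₀ hc, mul_comm]
    exact hco p0 hp0
  obtain ⟨p, hp, hmin⟩ := hcomp.exists_isMinOn ⟨p0, hp0m⟩
    (f := fun p => ⟪x, p⟫) (by fun_prop)
  refine ⟨p, hp.1, fun q hq => ?_⟩
  by_cases hqb : q ∈ Metric.closedBall (0 : EuclideanSpace ℝ (Fin n)) R
  · exact hmin ⟨hq, hqb⟩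
  · have h1 : ⟪x, p⟫ ≤ ⟪x, p0⟫ := hmin hp0m
    rw [mem_closedBall_zero_iff, not_le, hR, div_lt_iff₀ hc] at hqb
    linarith [hco q hq]

end CClose

/-- The (concave) gauge function of `K`. -/
noncomputable def gK {n : ℕ} (K : Set (EuclideanSpace ℝ (Fin n)))
    (x : EuclideanSpace ℝ (Fin n)) : ℝ := sInf ((fun p => ⟪x, p⟫) '' antiP K)

namespace CClose

variable {n : ℕ} {C K : Set (EuclideanSpace ℝ (Fin n))}

lemma gK_le (h : CClose C K) {x p : EuclideanSpace ℝ (Fin n)} (hx : x ∈ C) (hp : p ∈ antiP K) :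
    gK K x ≤ ⟪x, p⟫ := by
  refine csInf_le ⟨0, ?_⟩ ⟨p, hp, rfl⟩
  rintro _ ⟨q, hq, rfl⟩
  exact h.inner_nonneg_of_antiP hq hx

lemma le_gK (h : CClose C K) {x : EuclideanSpace ℝ (Fin n)} {a : ℝ}
    (ha : ∀ p ∈ antiP K, a ≤ ⟪x, p⟫) : a ≤ gK K x := by
  refine le_csInf (h.antiP_nonempty.image _) ?_
  rintro _ ⟨q, hq, rfl⟩
  exact ha q hq

lemma gK_eq (h : CClose C K) {x : EuclideanSpace ℝ (Fin n)} (hx : x ∈ interior C) :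
    ∃ p ∈ antiP K, gK K x = ⟪x, p⟫ := by
  obtain ⟨p, hp, hm⟩ := h.exists_min hx
  exact ⟨p, hp, le_antisymm (h.gK_le (interior_subset hx) hp) (h.le_gK hm)⟩

lemma gK_pos (h : CClose C K) {x : EuclideanSpace ℝ (Fin n)} (hx : x ∈ interior C) :
    0 < gK K x := by
  obtain ⟨p, hp, he⟩ := h.gK_eq hx
  rw [he]
  exact h.inner_pos_of_antiP hp (interior_subset hx)
    (by rintro rfl; exact h.zero_notMem_interior hx)

lemma gK_smul {t : ℝ} (ht : 0 ≤ t) (x : EuclideanSpace ℝ (Fin n)) :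
    gK K (t • x) = t * gK K x := by
  unfold gK
  have : (fun p => ⟪t • x, p⟫) '' antiP K = t • ((fun p => ⟪x, p⟫) '' antiP K) := by
    rw [← image_smul, image_image]
    simp [inner_smul_left]
  rw [this, Real.sInf_smul_of_nonneg ht, smul_eq_mul]

lemma one_le_gK (h : CClose C K) {x : EuclideanSpace ℝ (Fin n)} (hx : x ∈ K) : 1 ≤ gK K x :=
  h.le_gK fun _ hp => hp x hx

lemma mem_K_of_one_le (h : CClose C K) {x : EuclideanSpace ℝ (Fin n)} (hx : x ∈ C)
    (h1 : 1 ≤ gK K x) : x ∈ K := by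
  by_contra hxK
  obtain ⟨p, hp, hlt⟩ := h.exists_sep hx hxK
  linarith [h.gK_le hx hp]

lemma notMem_iff (h : CClose C K) {x : EuclideanSpace ℝ (Fin n)} (hx : x ∈ C) :
    x ∉ K ↔ gK K x < 1 := by
  constructor
  · intro hk
    by_contra hcon
    exact hk (h.mem_K_of_one_le hx (not_lt.1 hcon))
  · intro hl hk
    linarith [h.one_le_gK hk]

lemma inv_smul_mem (h : CClose C K) {x : EuclideanSpace ℝ (Fin n)} (hx : x ∈ interior C) :
    (gK K x)⁻¹ • x ∈ K := by
  have hg := h.gK_pos hx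
  refine h.mem_K_of_one_le (h.C_cone x (interior_subset hx) _ (inv_nonneg.2 hg.le)) ?_
  rw [gK_smul (inv_nonneg.2 hg.le), inv_mul_cancel₀ hg.ne']

lemma gK_concave (h : CClose C K) : ConcaveOn ℝ (interior C) (gK K) := by
  refine ⟨h.C_conv.interior, fun x hx y hy a b ha hb hab => h.le_gK fun p hp => ?_⟩
  rw [inner_add_left, inner_smul_left, inner_smul_left]
  simp only [conj_trivial, smul_eq_mul]
  have := h.gK_le (interior_subset hx) hp
  have := h.gK_le (interior_subset hy) hp
  gcongr

lemma gK_ae_diff (h : CClose C K) :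
    ∀ᵐ x ∂(volume : Measure (EuclideanSpace ℝ (Fin n))), x ∈ interior C →
      DifferentiableAt ℝ (gK K) x := by
  have hl := h.gK_concave.locallyLipschitzOn isOpen_interior
  have key : ∀ x ∈ interior C, ∃ U : Set (EuclideanSpace ℝ (Fin n)), IsOpen U ∧ x ∈ U ∧
      ∀ᵐ y ∂(volume : Measure (EuclideanSpace ℝ (Fin n))), y ∈ U →
        DifferentiableAt ℝ (gK K) y := by
    intro x hx
    obtain ⟨k, t, ht, hLip⟩ := hl hx
    rw [isOpen_interior.nhdsWithin_eq hx] at ht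
    obtain ⟨U, hUt, hUo, hxU⟩ := mem_nhds_iff.1 ht
    refine ⟨U, hUo, hxU, ?_⟩
    filter_upwards [(hLip.mono hUt).ae_differentiableWithinAt_of_mem (μ := volume)] with y hy hyU
    exact (hy hyU).differentiableAt (hUo.mem_nhds hyU)
  choose! U hUo hxU hU using key
  obtain ⟨s, hs, hsc, hcov⟩ := TopologicalSpace.countable_cover_nhdsWithin (s := interior C) (f := U)
    (fun x hx => mem_nhdsWithin_of_mem_nhds ((hUo x hx).mem_nhds (hxU x hx)))
  have : ∀ᵐ y ∂(volume : Measure (EuclideanSpace ℝ (Fin n))), ∀ x ∈ s, y ∈ U x →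
        DifferentiableAt ℝ (gK K) y :=
    (ae_ball_iff hsc).2 fun x hx => hU x (hs hx)
  filter_upwards [this] with y hy hyC
  obtain ⟨x, hx, hxy⟩ := mem_iUnion₂.1 (hcov hyC)
  exact hy x hx hxy

/-- at differentiability points, the touching functional is unique -/
lemma touching_unique (h : CClose C K) {x p q : EuclideanSpace ℝ (Fin n)} (hx : x ∈ interior C)
    (hd : DifferentiableAt ℝ (gK K) x) (hp : p ∈ antiP K) (hq : q ∈ antiP K)
    (hxp : gK K x = ⟪x, p⟫) (hxq : gK K x = ⟪x, q⟫) : p = q := by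
  have key : ∀ r ∈ antiP K, gK K x = ⟪x, r⟫ → fderiv ℝ (gK K) x = innerSL ℝ r := by
    intro r hr hxr
    have hmin : IsLocalMin (fun y => innerSL ℝ r y - gK K y) x := by
      filter_upwards [isOpen_interior.mem_nhds hx] with y hy
      have := h.gK_le (interior_subset hy) hr
      simp only [innerSL_apply_apply]
      rw [real_inner_comm, ← hxr, real_inner_comm]
      linarith
    have h0 := hmin.fderiv_eq_zero
    rw [fderiv_fun_sub (by fun_prop) hd, ContinuousLinearMap.fderiv, sub_eq_zero] at h0
    exact h0.symm
  have := (key p hp hxp).symm.trans (key q hq hxq)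
  exact (innerSL_inj).1 this

end CClose

section flat

variable {n : ℕ}

lemma exists_kappa (hn : 2 ≤ n) (w : EuclideanSpace ℝ (Fin n)) (hw : ‖w‖ = 1) :
    ∃ κ : ENNReal, ∀ W : Set (EuclideanSpace ℝ (Fin n)), MeasurableSet W → (∀ x ∈ W, ⟪x, w⟫ = 1) →
      volume (Ioo (0 : ℝ) 1 • W) = κ * μH[((n : ℝ) - 1)] W := by
  obtain ⟨k, rfl⟩ : ∃ k, n = k + 1 := ⟨n - 1, by omega⟩
  set F : Submodule ℝ (EuclideanSpace ℝ (Fin (k + 1))) := (ℝ ∙ w)ᗮ with hF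
  have hw0 : w ≠ 0 := by rintro rfl; simp at hw
  have hww : ⟪w, w⟫ = 1 := by rw [real_inner_self_eq_norm_sq, hw]; norm_num
  have : Fact (Module.finrank ℝ (EuclideanSpace ℝ (Fin (k + 1))) = k + 1) := ⟨by simp⟩
  have hfin : Module.finrank ℝ F = k := Submodule.finrank_orthogonal_span_singleton hw0
  have hFw : ∀ e : F, ⟪(e : EuclideanSpace ℝ (Fin (k + 1))), w⟫ = 0 := fun e => by
    rw [real_inner_comm]; exact Submodule.mem_orthogonal_singleton_iff_inner_right.1 e.2
  set ι : F → EuclideanSpace ℝ (Fin (k + 1)) := fun e => e + w with hι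
  set φ : EuclideanSpace ℝ (Fin (k + 1)) → F :=
    fun x => F.orthogonalProjectionOnto ((⟪x, w⟫)⁻¹ • x) with hφ
  have hφm : Measurable φ := by
    refine F.orthogonalProjectionOnto.continuous.measurable.comp ?_
    have h1 : Measurable fun x : EuclideanSpace ℝ (Fin (k + 1)) => ⟪x, w⟫ :=
      (by fun_prop : Continuous fun x : EuclideanSpace ℝ (Fin (k + 1)) => ⟪x, w⟫).measurable
    exact h1.inv.smul measurable_id
  have hproj : ∀ y : EuclideanSpace ℝ (Fin (k + 1)), ∀ e : F, y = e + ⟪y, w⟫ • w →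
      F.orthogonalProjectionOnto y = e := by
    intro y e hy
    rw [hy, map_add, map_smul]
    have h1 : F.orthogonalProjectionOnto w = 0 := by
      apply Submodule.orthogonalProjectionOnto_apply_of_mem_orthogonal
      rw [hF, Submodule.orthogonal_orthogonal]
      exact Submodule.mem_span_singleton_self w
    rw [h1]; simp
  have hdecomp : ∀ y : EuclideanSpace ℝ (Fin (k + 1)), ∃ e : F, y = e + ⟪y, w⟫ • w := by
    intro y
    refine ⟨⟨y - ⟪y, w⟫ • w, ?_⟩, by simp⟩
    rw [hF, Submodule.mem_orthogonal_singleton_iff_inner_right, inner_sub_right, inner_smul_right,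
      hww, real_inner_comm]
    simp
  have hφx : ∀ x, ⟪x, w⟫ ≠ 0 → (φ x : EuclideanSpace ℝ (Fin (k + 1))) + w = (⟪x, w⟫)⁻¹ • x := by
    intro x hx
    obtain ⟨e, he⟩ := hdecomp ((⟪x, w⟫)⁻¹ • x)
    have h1 : φ x = e := hproj _ _ he
    have h2 : ⟪(⟪x, w⟫)⁻¹ • x, w⟫ = 1 := by
      rw [inner_smul_left]; simp [hx]
    rw [h1]
    rw [h2, one_smul] at he
    exact he.symm
  set Q : Set (EuclideanSpace ℝ (Fin (k + 1))) := {x | 0 < ⟪x, w⟫ ∧ ⟪x, w⟫ < 1} with hQ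
  have hQm : MeasurableSet Q :=
    (IsOpen.inter (isOpen_lt continuous_const
        (by fun_prop : Continuous fun x : EuclideanSpace ℝ (Fin (k + 1)) => ⟪x, w⟫))
      (isOpen_lt (by fun_prop : Continuous fun x : EuclideanSpace ℝ (Fin (k + 1)) => ⟪x, w⟫)
        continuous_const)).measurableSet
  set m : Measure F := Measure.map φ (volume.restrict Q) with hm
  have hinv : m.IsAddLeftInvariant := by
    constructor
    intro v
    set L : EuclideanSpace ℝ (Fin (k + 1)) →ₗ[ℝ] EuclideanSpace ℝ (Fin (k + 1)) :=
      LinearMap.transvection ((innerSL ℝ w).toLinearMap) v with hL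
    have hLx : ∀ x, L x = x + ⟪x, w⟫ • (v : EuclideanSpace ℝ (Fin (k + 1))) := by
      intro x; rw [hL, LinearMap.transvection.apply]; simp [real_inner_comm]
    have hdet : LinearMap.det L = 1 := by
      rw [hL, LinearMap.transvection.det]
      have := hFw v
      rw [real_inner_comm] at this
      simp [this]
    have hLm : Measurable L := L.continuous_of_finiteDimensional.measurable
    have hmp : MeasurePreserving L volume volume := by
      refine ⟨hLm, ?_⟩
      rw [Measure.map_linearMap_addHaar_eq_smul_addHaar _ (by rw [hdet]; norm_num), hdet]
      simp
    have hLw : ∀ x, ⟪L x, w⟫ = ⟪x, w⟫ := by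
      intro x; rw [hLx, inner_add_left, inner_smul_left, hFw v]; simp
    have hpre : L ⁻¹' Q = Q := by
      ext x; simp only [hQ, mem_preimage, mem_ofPred_eq, hLw]
    have hmp2 : MeasurePreserving L (volume.restrict Q) (volume.restrict Q) := by
      have := hmp.restrict_preimage hQm
      rwa [hpre] at this
    rw [hm, Measure.map_map (by fun_prop) hφm]
    have hc : (fun x => v + x) ∘ φ =ᵐ[volume.restrict Q] φ ∘ L := by
      filter_upwards [ae_restrict_mem hQm] with x hx
      have hx0 : ⟪x, w⟫ ≠ 0 := hx.1.ne'
      apply Subtype.ext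
      have h1 := hφx x hx0
      have h2 := hφx (L x) (by rw [hLw]; exact hx0)
      rw [hLw, hLx, smul_add, smul_smul, inv_mul_cancel₀ hx0, one_smul, ← h1] at h2
      simp only [Function.comp, Submodule.coe_add]
      have h3 : (φ (L x) : EuclideanSpace ℝ (Fin (k + 1))) = φ x + v := by
        rw [← hLx] at h2
        have := congrArg (fun z => z - w) h2
        simp only [add_sub_cancel_right] at this
        rw [this]; abel
      rw [h3]; abel
    rw [Measure.map_congr hc, ← Measure.map_map hφm hLm, hmp2.map_eq]
  have hcpt : IsFiniteMeasureOnCompacts m := by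
    constructor
    intro S hS
    obtain ⟨R, hR⟩ := hS.isBounded.exists_norm_le
    rw [hm, Measure.map_apply hφm hS.measurableSet, Measure.restrict_apply (hφm hS.measurableSet)]
    refine lt_of_le_of_lt (measure_mono ?_)
      (measure_closedBall_lt_top (x := (0 : EuclideanSpace ℝ (Fin (k + 1)))) (r := |R| + 1))
    rintro x ⟨hx1, hx2⟩
    have h1 := hφx x hx2.1.ne'
    have h2 : x = ⟪x, w⟫ • ((φ x : EuclideanSpace ℝ (Fin (k + 1))) + w) := by
      rw [h1, smul_smul, mul_inv_cancel₀ hx2.1.ne', one_smul]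
    rw [mem_closedBall_zero_iff, h2, norm_smul, Real.norm_of_nonneg hx2.1.le]
    have h3 : ‖(φ x : EuclideanSpace ℝ (Fin (k + 1))) + w‖ ≤ |R| + 1 := by
      refine (norm_add_le _ _).trans ?_
      rw [hw]
      have := hR _ hx1
      rw [← Submodule.coe_norm]
      linarith [le_abs_self R]
    calc _ ≤ 1 * (|R| + 1) := mul_le_mul hx2.2.le h3 (norm_nonneg _) zero_le_one
      _ = _ := one_mul _
  have hd : (Module.finrank ℝ F : ℝ) = ((k + 1 : ℕ) : ℝ) - 1 := by rw [hfin]; push_cast; ring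
  have huniq := Measure.isAddLeftInvariant_eq_smul m (μH[(Module.finrank ℝ F : ℝ)] : Measure F)
  refine ⟨(Measure.addHaarScalarFactor m (μH[(Module.finrank ℝ F : ℝ)] : Measure F) : NNReal),
    fun W hW hW1 => ?_⟩
  have hιiso : Isometry ι := by
    refine Isometry.of_dist_eq fun a b => ?_
    simp [hι, dist_eq_norm]
  have hset : Ioo (0 : ℝ) 1 • W = φ ⁻¹' (ι ⁻¹' W) ∩ Q := by
    ext x
    rw [mem_smul]
    constructor
    · rintro ⟨t, ht, y, hy, rfl⟩
      have hy1 := hW1 y hy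
      have hs : ⟪t • y, w⟫ = t := by rw [inner_smul_left, hy1]; simp
      refine ⟨?_, ?_⟩
      · have := hφx (t • y) (by rw [hs]; exact ht.1.ne')
        rw [hs, smul_smul, inv_mul_cancel₀ ht.1.ne', one_smul] at this
        change (φ (t • y) : EuclideanSpace ℝ (Fin (k + 1))) + w ∈ W
        rwa [this]
      · change 0 < ⟪t • y, w⟫ ∧ ⟪t • y, w⟫ < 1
        rw [hs]; exact ht
    · rintro ⟨h1, h2⟩
      have h3 := hφx x h2.1.ne'
      change (φ x : EuclideanSpace ℝ (Fin (k + 1))) + w ∈ W at h1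
      rw [h3] at h1
      exact ⟨⟪x, w⟫, h2, _, h1, by rw [smul_smul, mul_inv_cancel₀ h2.1.ne', one_smul]⟩
  have hWm : MeasurableSet (ι ⁻¹' W) := hιiso.continuous.measurable hW
  have himg : ι '' (ι ⁻¹' W) = W := by
    rw [image_preimage_eq_iff]
    intro y hy
    obtain ⟨e, he⟩ := hdecomp y
    rw [hW1 y hy, one_smul] at he
    exact ⟨e, he.symm⟩
  have e1 : volume (Ioo (0 : ℝ) 1 • W) = m (ι ⁻¹' W) := by
    rw [hset, hm, Measure.map_apply hφm hWm, Measure.restrict_apply (hφm hWm)]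
  have e2 : μH[((k + 1 : ℕ) : ℝ) - 1] W = μH[(Module.finrank ℝ F : ℝ)] (ι ⁻¹' W) := by
    rw [← hd, ← hιiso.hausdorffMeasure_image (Or.inl (by positivity)), himg]
  rw [e1, e2]
  have e3 := congrArg (fun μ : Measure F => μ (ι ⁻¹' W)) huniq
  simp only [Measure.smul_apply, ENNReal.smul_def, smul_eq_mul] at e3
  exact e3

end flat

/-- The open set of unit vectors in the interior of the polar cone. -/
def OmC {n : ℕ} (C : Set (EuclideanSpace ℝ (Fin n))) : Set (EuclideanSpace ℝ (Fin n)) :=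
  Metric.sphere (0 : EuclideanSpace ℝ (Fin n)) 1 ∩
        interior {x : EuclideanSpace ℝ (Fin n) | ∀ y ∈ C, ⟪x, y⟫ ≤ 0}

section cells

variable {n : ℕ} {C K K₀ K₁ : Set (EuclideanSpace ℝ (Fin n))}

lemma OmC_coercive {u : EuclideanSpace ℝ (Fin n)} (hu : u ∈ OmC C) :
    ∃ c > 0, ∀ y ∈ C, c * ‖y‖ ≤ ⟪y, -u⟫ := by
  have h := hu.2
  rw [mem_interior_iff_mem_nhds, Metric.mem_nhds_iff] at h
  obtain ⟨r, hr, hb⟩ := h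
  refine ⟨r / 2, by positivity, fun y hy => ?_⟩
  by_cases hy0 : y = 0
  · simp [hy0]
  have hyn : 0 < ‖y‖ := norm_pos_iff.2 hy0
  have hm : u + (r / (2 * ‖y‖)) • y ∈ {x : EuclideanSpace ℝ (Fin n) | ∀ y ∈ C, ⟪x, y⟫ ≤ 0} := hb (by
    rw [Metric.mem_ball, dist_eq_norm, add_sub_cancel_left, norm_smul,
      Real.norm_of_nonneg (by positivity)]
    have : r / (2 * ‖y‖) * ‖y‖ = r / 2 := by field_simp
    rw [this]; linarith)
  have := hm y hy
  rw [inner_add_left, inner_smul_left, real_inner_self_eq_norm_sq] at this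
  simp only [conj_trivial] at this
  have h3 : (r / (2 * ‖y‖)) * ‖y‖^2 = r / 2 * ‖y‖ := by field_simp
  rw [inner_neg_right, real_inner_comm]
  linarith

lemma CClose.normal_mem (h : CClose C K) {p : EuclideanSpace ℝ (Fin n)} (hp : p ∈ antiP K) :
    (-‖p‖⁻¹) • p ∈ OmC C := by
  have hpn : 0 < ‖p‖ := norm_pos_iff.2 (h.antiP_ne_zero hp)
  refine ⟨by simp [norm_smul, hpn.ne'], ?_⟩
  obtain ⟨δ, hδ, hδC⟩ : ∃ δ > 0, ∀ y ∈ C, δ * ‖y‖ ≤ ⟪y, p⟫ := by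
    have hcomp : IsCompact (C ∩ Metric.sphere 0 1) := (isCompact_sphere _ _).inter_left h.C_closed
    obtain ⟨y0, hy0, hy0n⟩ := h.exists_ne
    have hne : (C ∩ Metric.sphere 0 1).Nonempty := by
      refine ⟨‖y0‖⁻¹ • y0, h.C_cone _ hy0 _ (by positivity), ?_⟩
      have : ‖y0‖ ≠ 0 := norm_ne_zero_iff.2 hy0n
      simp [norm_smul, this]
    obtain ⟨z, hz, hmin⟩ := hcomp.exists_isMinOn hne (f := fun y => ⟪y, p⟫) (by fun_prop)
    refine ⟨⟪z, p⟫, h.inner_pos_of_antiP hp hz.1 ?_, fun y hy => ?_⟩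
    · rintro rfl; have := hz.2; simp at this
    · by_cases hy0 : y = 0
      · simp [hy0]
      have hyn : 0 < ‖y‖ := norm_pos_iff.2 hy0
      have h1 : ⟪z, p⟫ ≤ ⟪‖y‖⁻¹ • y, p⟫ := hmin ⟨h.C_cone _ hy _ (by positivity), by
        simp [norm_smul, hyn.ne']⟩
      rw [inner_smul_left] at h1
      simp only [conj_trivial] at h1
      rwa [← div_eq_inv_mul, le_div_iff₀ hyn] at h1
  rw [mem_interior_iff_mem_nhds, Metric.mem_nhds_iff]
  refine ⟨δ / ‖p‖, by positivity, fun x hx y hy => ?_⟩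
  rw [Metric.mem_ball, dist_eq_norm] at hx
  set u := (-‖p‖⁻¹) • p with hu
  have h1 : ⟪x, y⟫ = ⟪u, y⟫ + ⟪x - u, y⟫ := by rw [← inner_add_left]; simp
  have h2 : ⟪u, y⟫ ≤ -(δ * ‖y‖ / ‖p‖) := by
    rw [hu, inner_smul_left, real_inner_comm]
    simp only [conj_trivial]
    have := hδC y hy
    have h3 : δ * ‖y‖ / ‖p‖ ≤ ⟪y, p⟫ / ‖p‖ := by gcongr
    have h4 : -‖p‖⁻¹ * ⟪y, p⟫ = -(⟪y, p⟫ / ‖p‖) := by ring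
    linarith
  have h3 : ⟪x - u, y⟫ ≤ δ / ‖p‖ * ‖y‖ := by
    refine (real_inner_le_norm _ _).trans ?_
    gcongr
  have h4 : δ / ‖p‖ * ‖y‖ = δ * ‖y‖ / ‖p‖ := by ring
  linarith

lemma CClose.cover (h : CClose C K) :
    interior C \ K ⊆ Ioo (0 : ℝ) 1 • revSphImage K (OmC C) := by
  rintro x ⟨hx, hxK⟩
  have hg := h.gK_pos hx
  have hg1 := (h.notMem_iff (interior_subset hx)).1 hxK
  obtain ⟨p, hp, he⟩ := h.gK_eq hx
  have hpn : 0 < ‖p‖ := norm_pos_iff.2 (h.antiP_ne_zero hp)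
  have hyK := h.inv_smul_mem hx
  have hnorm : ∀ z ∈ K, ⟪z, (-‖p‖⁻¹) • p⟫ ≤ ⟪(gK K x)⁻¹ • x, (-‖p‖⁻¹) • p⟫ := by
    intro z hz
    rw [inner_smul_right, inner_smul_right, inner_smul_left]
    simp only [conj_trivial]
    rw [← he, inv_mul_cancel₀ hg.ne']
    have := hp z hz
    have h5 : 0 < ‖p‖⁻¹ := by positivity
    nlinarith
  refine mem_smul.2 ⟨gK K x, ⟨hg, hg1⟩, (gK K x)⁻¹ • x, ?_, by
    rw [smul_smul, mul_inv_cancel₀ hg.ne', one_smul]⟩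
  refine ⟨?_, _, h.normal_mem hp, ?_, hnorm⟩
  · refine ⟨subset_closure hyK, fun hint => ?_⟩
    -- interior point contradiction
    rw [mem_interior_iff_mem_nhds, Metric.mem_nhds_iff] at hint
    obtain ⟨r, hr, hb⟩ := hint
    have hm : (gK K x)⁻¹ • x - (r / (2 * ‖p‖)) • p ∈ K := hb (by
      rw [Metric.mem_ball, dist_eq_norm, sub_sub_cancel_left, norm_neg, norm_smul,
        Real.norm_of_nonneg (by positivity)]
      have : r / (2 * ‖p‖) * ‖p‖ = r / 2 := by field_simp
      rw [this]; linarith)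
    have h6 := hp _ hm
    rw [inner_sub_left, inner_smul_left, inner_smul_left, ← he, real_inner_self_eq_norm_sq] at h6
    simp only [conj_trivial] at h6
    rw [inv_mul_cancel₀ hg.ne'] at h6
    have : 0 < r / (2 * ‖p‖) * ‖p‖ ^ 2 := by positivity
    linarith
  · exact (mem_sphere_zero_iff_norm).1 (h.normal_mem hp).1

/-- data for points of the reverse spherical image -/
lemma CClose.rev_mem (h : CClose C K) {ω : Set (EuclideanSpace ℝ (Fin n))}
    {y : EuclideanSpace ℝ (Fin n)} (hy : y ∈ revSphImage K ω) :
    y ∈ K ∧ ∃ u ∈ ω, ∀ z ∈ K, ⟪z, u⟫ ≤ ⟪y, u⟫ := by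
  obtain ⟨hy1, u, hu, _, hn⟩ := hy
  exact ⟨h.K_closed.frontier_subset hy1, u, hu, hn⟩

lemma CClose.rev_antiP (h : CClose C K) {u y : EuclideanSpace ℝ (Fin n)} (hu : u ∈ OmC C)
    (hy : y ∈ K) (hn : ∀ z ∈ K, ⟪z, u⟫ ≤ ⟪y, u⟫) :
    ⟪y, u⟫ < 0 ∧ (⟪y, u⟫)⁻¹ • u ∈ antiP K := by
  obtain ⟨c, hc, hcC⟩ := OmC_coercive hu
  have hy0 : 0 < ‖y‖ := norm_pos_iff.2 (by rintro rfl; exact h.zero_notMem hy)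
  have h1 := hcC y (h.K_sub hy)
  rw [inner_neg_right] at h1
  have h2 : ⟪y, u⟫ < 0 := by nlinarith
  refine ⟨h2, fun z hz => ?_⟩
  rw [inner_smul_right, ← div_eq_inv_mul, le_div_iff_of_neg h2, one_mul]
  exact hn z hz

lemma CClose.cone_gK (h : CClose C K) {u y : EuclideanSpace ℝ (Fin n)} (hu : u ∈ OmC C)
    (hy : y ∈ K) (hn : ∀ z ∈ K, ⟪z, u⟫ ≤ ⟪y, u⟫) : gK K y = 1 := by
  obtain ⟨h1, h2⟩ := h.rev_antiP hu hy hn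
  refine le_antisymm ((h.gK_le (h.K_sub hy) h2).trans ?_) (h.one_le_gK hy)
  rw [inner_smul_right, inv_mul_cancel₀ h1.ne]

/-- The minimum of the linear functional. -/
noncomputable def aK (K : Set (EuclideanSpace ℝ (Fin n))) (w : EuclideanSpace ℝ (Fin n)) : ℝ :=
  sInf ((fun y => ⟪y, w⟫) '' K)

lemma CClose.aK_le (h : CClose C K) {w : EuclideanSpace ℝ (Fin n)} {c : ℝ} (hc : 0 < c)
    (hcC : ∀ y ∈ C, c * ‖y‖ ≤ ⟪y, w⟫) {y : EuclideanSpace ℝ (Fin n)} (hy : y ∈ K) :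
    aK K w ≤ ⟪y, w⟫ := by
  refine csInf_le ⟨0, ?_⟩ ⟨y, hy, rfl⟩
  rintro _ ⟨z, hz, rfl⟩
  exact le_trans (by positivity) (hcC z (h.K_sub hz))

lemma CClose.aK_pos (h : CClose C K) {w : EuclideanSpace ℝ (Fin n)} {c : ℝ} (hc : 0 < c)
    (hcC : ∀ y ∈ C, c * ‖y‖ ≤ ⟪y, w⟫) : 0 < aK K w := by
  have hd : 0 < Metric.infDist 0 K :=
    (h.K_closed.notMem_iff_infDist_pos h.K_nonempty).1 h.zero_notMem
  refine lt_of_lt_of_le (mul_pos hc hd) (le_csInf (h.K_nonempty.image _) ?_)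
  rintro _ ⟨z, hz, rfl⟩
  refine le_trans ?_ (hcC z (h.K_sub hz))
  gcongr
  simpa using Metric.infDist_le_dist_of_mem (x := 0) hz

section single

variable {w : EuclideanSpace ℝ (Fin n)} {c θ : ℝ} {ω : Set (EuclideanSpace ℝ (Fin n))}

lemma CClose.T_bound (h : CClose C K) (hc : 0 < c)
    (hcC : ∀ y ∈ C, c * ‖y‖ ≤ ⟪y, w⟫) (hθ : 0 < θ) (hθ1 : θ < 1)
    (hω : ω ⊆ Metric.closedBall (-w) (c * θ)) {x : EuclideanSpace ℝ (Fin n)}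
    (hx : x ∈ revSphImage K ω) : ⟪x, w⟫ ≤ (1 + θ) / (1 - θ) * aK K w := by
  obtain ⟨hxK, u, hu, hn⟩ := h.rev_mem hx
  have hu2 := hω hu
  rw [Metric.mem_closedBall, dist_eq_norm] at hu2
  have key : ∀ y ∈ C, |⟪y, -u⟫ - ⟪y, w⟫| ≤ θ * ⟪y, w⟫ := by
    intro y hy
    have e : ⟪y, -u⟫ - ⟪y, w⟫ = -⟪y, u - -w⟫ := by
      rw [inner_sub_right, inner_neg_right, inner_neg_right]; ring
    rw [e, abs_neg]
    calc _ ≤ ‖y‖ * ‖u - -w‖ := abs_real_inner_le_norm _ _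
      _ ≤ ‖y‖ * (c * θ) := by gcongr
      _ = θ * (c * ‖y‖) := by ring
      _ ≤ _ := by gcongr; exact hcC y hy
  have h1 : (1 - θ) / (1 + θ) * ⟪x, w⟫ ≤ aK K w := by
    refine le_csInf (h.K_nonempty.image _) ?_
    rintro _ ⟨z, hz, rfl⟩
    have k1 := key x (h.K_sub hxK)
    have k2 := key z (h.K_sub hz)
    have k3 := hn z hz
    rw [abs_le] at k1 k2
    simp only [inner_neg_right] at k1 k2
    simp only
    rw [div_mul_eq_mul_div, div_le_iff₀ (by linarith)]
    linarith
  rw [div_mul_eq_mul_div, le_div_iff₀ (by linarith)]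
  rw [div_mul_eq_mul_div, div_le_iff₀ (by linarith)] at h1
  linarith

lemma CClose.T_flat (h : CClose C K) 
    (hω : ω ⊆ Metric.closedBall (-w) (c * θ)) {x y : EuclideanSpace ℝ (Fin n)}
    (hx : x ∈ revSphImage K ω) (hy : y ∈ revSphImage K ω) :
    |⟪x, w⟫ - ⟪y, w⟫| ≤ c * θ * ‖x - y‖ := by
  have key : ∀ x y, x ∈ revSphImage K ω → y ∈ revSphImage K ω →
      ⟪x, w⟫ - ⟪y, w⟫ ≤ c * θ * ‖x - y‖ := by
    intro x y hx hy
    obtain ⟨hxK, u, hu, hn⟩ := h.rev_mem hx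
    obtain ⟨hyK, -⟩ := h.rev_mem hy
    have hu2 := hω hu
    rw [Metric.mem_closedBall, dist_eq_norm] at hu2
    have h1 := hn y hyK
    have e : ⟪x, w⟫ - ⟪y, w⟫ = ⟪x - y, u - -w⟫ - (⟪x, u⟫ - ⟪y, u⟫) := by
      simp only [inner_sub_right, inner_neg_right, inner_sub_left]; ring
    have h2 : ⟪x - y, u - -w⟫ ≤ ‖x - y‖ * ‖u - -w‖ := real_inner_le_norm _ _
    have h3 : ‖x - y‖ * ‖u - -w‖ ≤ ‖x - y‖ * (c * θ) := by gcongr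
    linarith
  rw [abs_le]
  have h1 := key x y hx hy
  have h2 := key y x hy hx
  rw [norm_sub_rev] at h2
  constructor <;> linarith

lemma CClose.T_compact (h : CClose C K) (hc : 0 < c)
    (hcC : ∀ y ∈ C, c * ‖y‖ ≤ ⟪y, w⟫) (hθ : 0 < θ) (hθ1 : θ < 1)
    (hω : ω ⊆ Metric.closedBall (-w) (c * θ)) (hωc : IsCompact ω) :
    IsCompact (revSphImage K ω) := by
  set R := (1 + θ) / (1 - θ) * aK K w / c with hR
  set Z : Set (EuclideanSpace ℝ (Fin n) × EuclideanSpace ℝ (Fin n)) :=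
    {z | z.1 ∈ frontier K ∧ ‖z.2‖ = 1 ∧ ∀ y ∈ K, ⟪y, z.2⟫ ≤ ⟪z.1, z.2⟫} with hZ
  have hZc : IsClosed Z := by
    refine IsClosed.inter (isClosed_frontier.preimage continuous_fst) (IsClosed.inter
      (isClosed_eq (by fun_prop) continuous_const) ?_)
    have : {z : EuclideanSpace ℝ (Fin n) × EuclideanSpace ℝ (Fin n) |
        ∀ y ∈ K, ⟪y, z.2⟫ ≤ ⟪z.1, z.2⟫} = ⋂ y ∈ K, {z | ⟪y, z.2⟫ ≤ ⟪z.1, z.2⟫} := by ext; simp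
    change IsClosed {z : EuclideanSpace ℝ (Fin n) × EuclideanSpace ℝ (Fin n) |
        ∀ y ∈ K, ⟪y, z.2⟫ ≤ ⟪z.1, z.2⟫}
    rw [this]
    exact isClosed_biInter fun y _ => isClosed_le (by fun_prop) (by fun_prop)
  have hcomp : IsCompact ((Metric.closedBall (0 : EuclideanSpace ℝ (Fin n)) R ×ˢ ω) ∩ Z) :=
    ((isCompact_closedBall _ _).prod hωc).inter_right hZc
  convert hcomp.image continuous_fst using 1
  ext x
  constructor
  · intro hx
    have hb := h.T_bound hc hcC hθ hθ1 hω hx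
    have hxC := h.K_sub (h.rev_mem hx).1
    obtain ⟨hxf, u, hu, hu1, hn⟩ := hx
    refine ⟨(x, u), ⟨⟨?_, hu⟩, hxf, hu1, hn⟩, rfl⟩
    rw [mem_closedBall_zero_iff, hR, le_div_iff₀ hc, mul_comm]
    exact (hcC x hxC).trans hb
  · rintro ⟨⟨x', u⟩, ⟨⟨_, hu⟩, hxf, hu1, hn⟩, rfl⟩
    exact ⟨hxf, u, hu, hu1, hn⟩

lemma CClose.cell_single (h : CClose C K) (hc : 0 < c)
    (hcC : ∀ y ∈ C, c * ‖y‖ ≤ ⟪y, w⟫) (hθ : 0 < θ) (hθ1 : θ < 1)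
    (hω : ω ⊆ Metric.closedBall (-w) (c * θ)) (hωc : IsCompact ω)
    (κ : ENNReal) (hκ : ∀ W : Set (EuclideanSpace ℝ (Fin n)), MeasurableSet W →
      (∀ x ∈ W, ⟪x, w⟫ = 1) → volume (Ioo (0 : ℝ) 1 • W) = κ * μH[((n : ℝ) - 1)] W)
    {q : ℝ} (hq : q = (1 + θ) / (1 - θ)) :
    volume (Ioo (0 : ℝ) 1 • revSphImage K ω) ≤
      ENNReal.ofReal (q ^ (2 * n) * aK K w) * (κ * μH[((n : ℝ) - 1)] (revSphImage K ω)) ∧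
    ENNReal.ofReal (aK K w) * (κ * μH[((n : ℝ) - 1)] (revSphImage K ω)) ≤
      ENNReal.ofReal (q ^ (2 * n)) * volume (Ioo (0 : ℝ) 1 • revSphImage K ω) := by
  obtain ⟨k, rfl⟩ : ∃ k, n = k + 1 := ⟨n - 1, by have := h.dim; omega⟩
  set T := revSphImage K ω with hT
  set a := aK K w with ha
  have ha0 : 0 < a := h.aK_pos hc hcC
  have hTK : ∀ x ∈ T, x ∈ K := fun x hx => (h.rev_mem hx).1
  have hs1 : ∀ x ∈ T, a ≤ ⟪x, w⟫ := fun x hx => h.aK_le hc hcC (hTK x hx)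
  have hs2 : ∀ x ∈ T, ⟪x, w⟫ ≤ q * a := fun x hx => hq ▸ h.T_bound hc hcC hθ hθ1 hω hx
  have hTc : IsCompact T := h.T_compact hc hcC hθ hθ1 hω hωc
  have hq1 : 1 + θ ≤ q := by
    rw [hq, le_div_iff₀ (by linarith)]; nlinarith
  have hq2 : 1 / (1 - θ) ≤ q := by
    rw [hq]; gcongr; linarith
  have hq0 : 1 ≤ q := by linarith
  set π : EuclideanSpace ℝ (Fin (k + 1)) → EuclideanSpace ℝ (Fin (k + 1)) :=
    fun x => (⟪x, w⟫)⁻¹ • x with hπ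
  have hπc : ContinuousOn π T := by
    have hs : ContinuousOn (fun x : EuclideanSpace ℝ (Fin (k + 1)) => ⟪x, w⟫) T := by fun_prop
    exact (hs.inv₀ fun x hx => (ha0.trans_le (hs1 x hx)).ne').smul continuousOn_id
  have hWm : MeasurableSet (π '' T) := (hTc.image_of_continuousOn hπc).measurableSet
  have hW1 : ∀ x ∈ π '' T, ⟪x, w⟫ = 1 := by
    rintro _ ⟨x, hx, rfl⟩
    simp only [hπ, inner_smul_left, conj_trivial]
    exact inv_mul_cancel₀ (ha0.trans_le (hs1 x hx)).ne'
  have hWv := hκ _ hWm hW1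
  -- difference formula
  have hdiff : ∀ x ∈ T, ∀ y ∈ T, (1 - θ) / (q * a) * ‖x - y‖ ≤ ‖π x - π y‖ ∧
      ‖π x - π y‖ ≤ (1 + θ) / a * ‖x - y‖ := by
    intro x hx y hy
    have hsx : 0 < ⟪x, w⟫ := ha0.trans_le (hs1 x hx)
    have hsy : 0 < ⟪y, w⟫ := ha0.trans_le (hs1 y hy)
    have e : π x - π y = (⟪x, w⟫)⁻¹ • ((x - y) - (⟪x, w⟫ - ⟪y, w⟫) • π y) := by
      simp only [hπ, smul_sub, smul_smul, sub_mul, sub_smul, mul_sub]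
      rw [mul_inv_cancel₀ hsy.ne', mul_one, inv_mul_cancel_left₀ hsx.ne']
      abel
    have hpy : ‖π y‖ ≤ 1 / c := by
      simp only [hπ, norm_smul, norm_inv, Real.norm_of_nonneg hsy.le]
      rw [← div_eq_inv_mul, div_le_div_iff₀ hsy hc]
      have := hcC y (h.K_sub (hTK y hy))
      linarith
    have hfl := h.T_flat hω hx hy
    have hsm : ‖(⟪x, w⟫ - ⟪y, w⟫) • π y‖ ≤ θ * ‖x - y‖ := by
      rw [norm_smul, Real.norm_eq_abs]
      calc _ ≤ (c * θ * ‖x - y‖) * (1 / c) := by gcongr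
        _ = _ := by field_simp
    have n1 : ‖π x - π y‖ = (⟪x, w⟫)⁻¹ * ‖(x - y) - (⟪x, w⟫ - ⟪y, w⟫) • π y‖ := by
      rw [e, norm_smul, norm_inv, Real.norm_of_nonneg hsx.le]
    have n2 : ‖(x - y) - (⟪x, w⟫ - ⟪y, w⟫) • π y‖ ≤ (1 + θ) * ‖x - y‖ := by
      have := norm_sub_le (x - y) ((⟪x, w⟫ - ⟪y, w⟫) • π y)
      linarith
    have n3 : (1 - θ) * ‖x - y‖ ≤ ‖(x - y) - (⟪x, w⟫ - ⟪y, w⟫) • π y‖ := by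
      have := norm_sub_norm_le (x - y) ((⟪x, w⟫ - ⟪y, w⟫) • π y)
      linarith
    have i1 : (⟪x, w⟫)⁻¹ ≤ a⁻¹ := inv_anti₀ ha0 (hs1 x hx)
    have i2 : (q * a)⁻¹ ≤ (⟪x, w⟫)⁻¹ := inv_anti₀ hsx (hs2 x hx)
    rw [n1]
    constructor
    · calc (1 - θ) / (q * a) * ‖x - y‖ = (q * a)⁻¹ * ((1 - θ) * ‖x - y‖) := by ring
        _ ≤ _ := by
          have : 0 ≤ (1 - θ) * ‖x - y‖ := mul_nonneg (by linarith) (norm_nonneg _)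
          gcongr
    · calc _ ≤ a⁻¹ * ((1 + θ) * ‖x - y‖) := by gcongr
        _ = _ := by ring
  have hd : (((k + 1 : ℕ) : ℝ) - 1) = (k : ℝ) := by push_cast; ring
  rw [hd] at hWv ⊢
  -- Lipschitz estimates
  have hL1 : μH[(k : ℝ)] (π '' T) ≤ ENNReal.ofReal ((1 + θ) / a) ^ k * μH[(k : ℝ)] T := by
    have hl : LipschitzOnWith (Real.toNNReal ((1 + θ) / a)) π T := by
      refine LipschitzOnWith.of_dist_le_mul fun x hx y hy => ?_
      rw [dist_eq_norm, dist_eq_norm, Real.coe_toNNReal _ (by positivity)]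
      exact (hdiff x hx y hy).2
    have := hl.hausdorffMeasure_image_le (d := (k : ℝ)) (by positivity)
    rwa [ENNReal.rpow_natCast] at this
  have hL2 : μH[(k : ℝ)] T ≤ ENNReal.ofReal (q * a / (1 - θ)) ^ k * μH[(k : ℝ)] (π '' T) := by
    have hθ' : 0 < 1 - θ := by linarith
    have hl : AntilipschitzWith (Real.toNNReal (q * a / (1 - θ))) (T.domRestrict π) := by
      refine AntilipschitzWith.of_le_mul_dist fun x y => ?_
      rw [Subtype.dist_eq, dist_eq_norm, dist_eq_norm, Real.coe_toNNReal _ (by positivity)]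
      have := (hdiff x x.2 y y.2).1
      simp only [domRestrict_apply]
      rw [div_mul_eq_mul_div, div_le_iff₀ (by positivity)] at this
      rw [div_mul_eq_mul_div, le_div_iff₀ hθ']
      linarith
    have := hl.le_hausdorffMeasure_image (d := (k : ℝ)) (by positivity) univ
    rw [ENNReal.rpow_natCast, image_univ, range_domRestrict,
      ← isometry_subtype_coe.hausdorffMeasure_image (Or.inl (by positivity)), image_univ,
      Subtype.range_coe] at this
    exact this
  have hsub1 : Ioo (0 : ℝ) 1 • T ⊆ (q * a) • (Ioo (0 : ℝ) 1 • (π '' T)) := by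
    intro x hx
    obtain ⟨t, ht, y, hy, rfl⟩ := mem_smul.1 hx
    have hsy : 0 < ⟪y, w⟫ := ha0.trans_le (hs1 y hy)
    have hqa : 0 < q * a := by positivity
    refine ⟨(t * (⟪y, w⟫ / (q * a))) • π y, mem_smul.2 ⟨_, ⟨?_, ?_⟩, _, ⟨y, hy, rfl⟩, rfl⟩, ?_⟩
    · have := ht.1; positivity
    · have : ⟪y, w⟫ / (q * a) ≤ 1 := (div_le_one hqa).2 (hs2 y hy)
      have h0 := ht.1
      have h1 := ht.2
      nlinarith
    · simp only [hπ, smul_smul]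
      congr 1
      field_simp
  have hsub2 : a • (Ioo (0 : ℝ) 1 • (π '' T)) ⊆ Ioo (0 : ℝ) 1 • T := by
    rintro _ ⟨z, hz, rfl⟩
    obtain ⟨t, ht, _, ⟨y, hy, rfl⟩, rfl⟩ := mem_smul.1 hz
    have hsy : 0 < ⟪y, w⟫ := ha0.trans_le (hs1 y hy)
    refine mem_smul.2 ⟨t * (a / ⟪y, w⟫), ⟨?_, ?_⟩, y, hy, ?_⟩
    · have := ht.1; positivity
    · have : a / ⟪y, w⟫ ≤ 1 := (div_le_one hsy).2 (hs1 y hy)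
      have h0 := ht.1
      have h1 := ht.2
      nlinarith
    · simp only [hπ, smul_smul]
      congr 1
      field_simp
  have hfr : Module.finrank ℝ (EuclideanSpace ℝ (Fin (k + 1))) = k + 1 := by simp
  constructor
  · calc volume (Ioo (0 : ℝ) 1 • T) ≤ volume ((q * a) • (Ioo (0 : ℝ) 1 • (π '' T))) :=
          measure_mono hsub1
      _ = ENNReal.ofReal ((q * a) ^ (k + 1)) * (κ * μH[(k : ℝ)] (π '' T)) := by
          rw [Measure.addHaar_smul_of_nonneg _ (by positivity), hfr, hWv]
      _ ≤ ENNReal.ofReal ((q * a) ^ (k + 1)) *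
            (κ * (ENNReal.ofReal ((1 + θ) / a) ^ k * μH[(k : ℝ)] T)) := by gcongr
      _ = ENNReal.ofReal ((q * a) ^ (k + 1) * ((1 + θ) / a) ^ k) * (κ * μH[(k : ℝ)] T) := by
          rw [ENNReal.ofReal_mul (by positivity), ENNReal.ofReal_pow (p := (1 + θ) / a) (by positivity)]
          ring
      _ ≤ _ := by
          refine mul_le_mul' (ENNReal.ofReal_le_ofReal ?_) le_rfl
          have e : (q * a) ^ (k + 1) * ((1 + θ) / a) ^ k = q ^ (k + 1) * (1 + θ) ^ k * a := by
            rw [div_pow, mul_pow]; field_simp; ring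
          rw [e]
          have : (1 + θ) ^ k ≤ q ^ (k + 1) :=
            (pow_le_pow_left₀ (by linarith) hq1 k).trans (pow_le_pow_right₀ hq0 (by omega))
          calc q ^ (k + 1) * (1 + θ) ^ k * a ≤ q ^ (k + 1) * q ^ (k + 1) * a := by gcongr
            _ = _ := by ring
  · have hθ' : 0 < 1 - θ := by linarith
    calc ENNReal.ofReal a * (κ * μH[(k : ℝ)] T) ≤
          ENNReal.ofReal a * (κ * (ENNReal.ofReal (q * a / (1 - θ)) ^ k * μH[(k : ℝ)] (π '' T))) := by
          gcongr
      _ = ENNReal.ofReal (a * (q * a / (1 - θ)) ^ k) * (κ * μH[(k : ℝ)] (π '' T)) := by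
          rw [ENNReal.ofReal_mul (by positivity), ENNReal.ofReal_pow (by positivity)]
          ring
      _ ≤ ENNReal.ofReal (q ^ (2 * (k + 1)) * a ^ (k + 1)) * (κ * μH[(k : ℝ)] (π '' T)) := by
          refine mul_le_mul' (ENNReal.ofReal_le_ofReal ?_) le_rfl
          have e : a * (q * a / (1 - θ)) ^ k = q ^ k * (1 / (1 - θ)) ^ k * a ^ (k + 1) := by
            rw [div_pow, div_pow, mul_pow, one_pow]; field_simp; ring
          rw [e]
          have : (1 / (1 - θ)) ^ k ≤ q ^ (k + 2) :=
            (pow_le_pow_left₀ (by positivity) hq2 k).trans (pow_le_pow_right₀ hq0 (by omega))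
          calc q ^ k * (1 / (1 - θ)) ^ k * a ^ (k + 1) ≤ q ^ k * q ^ (k + 2) * a ^ (k + 1) := by gcongr
            _ = _ := by ring
      _ = ENNReal.ofReal (q ^ (2 * (k + 1))) * volume (a • (Ioo (0 : ℝ) 1 • (π '' T))) := by
          rw [Measure.addHaar_smul_of_nonneg _ (by positivity), hfr, hWv,
            ENNReal.ofReal_mul (by positivity)]
          ring
      _ ≤ _ := by gcongr

end single

lemma measurable_cone {T : Set (EuclideanSpace ℝ (Fin n))} (hT : IsCompact T) :
    MeasurableSet (Ioo (0 : ℝ) 1 • T) := by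
  obtain ⟨F, hF, -, hFU, -⟩ := (isOpen_Ioo (a := (0 : ℝ)) (b := 1)).exists_iUnion_isClosed
  rw [← hFU, iUnion_smul]
  refine MeasurableSet.iUnion fun k => ?_
  have : IsCompact (F k) :=
    isCompact_Icc.of_isClosed_subset (hF k) (((subset_iUnion F k).trans hFU.subset).trans Ioo_subset_Icc_self)
  have h2 := (this.prod hT).image (f := fun z : ℝ × EuclideanSpace ℝ (Fin n) => z.1 • z.2) (by fun_prop)
  rw [image_smul_prod] at h2
  exact h2.measurableSet

lemma CClose.cone_sub (h : CClose C K) {ω : Set (EuclideanSpace ℝ (Fin n))} :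
    Ioo (0 : ℝ) 1 • revSphImage K ω ⊆ C := by
  intro x hx
  obtain ⟨t, ht, y, hy, rfl⟩ := mem_smul.1 hx
  exact h.C_cone y (h.K_sub (h.rev_mem hy).1) t ht.1.le

lemma CClose.vol_inter (h : CClose C K) {S : Set (EuclideanSpace ℝ (Fin n))} (hS : S ⊆ C) :
    volume S = volume (S ∩ interior C) := by
  refine le_antisymm ?_ (measure_mono inter_subset_left)
  have h1 : S ⊆ (S ∩ interior C) ∪ frontier C := by
    intro x hx
    by_cases hi : x ∈ interior C
    · exact Or.inl ⟨hx, hi⟩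
    · exact Or.inr ⟨subset_closure (hS hx), hi⟩
  refine (measure_mono h1).trans ((measure_union_le _ _).trans ?_)
  rw [h.C_conv.addHaar_frontier volume, add_zero]

lemma cell_ineq (h₀ : CClose C K₀) (h₁ : CClose C K₁)
    {w : EuclideanSpace ℝ (Fin n)} {c θ : ℝ} {ω : Set (EuclideanSpace ℝ (Fin n))}
    (hw : ‖w‖ = 1) (hc : 0 < c)
    (hcC : ∀ y ∈ C, c * ‖y‖ ≤ ⟪y, w⟫) (hθ : 0 < θ) (hθ1 : θ < 1)
    (hω : ω ⊆ Metric.closedBall (-w) (c * θ)) (hωc : IsCompact ω) (hωO : ω ⊆ OmC C)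
    (hS : μH[((n : ℝ) - 1)] (revSphImage K₀ ω) = μH[((n : ℝ) - 1)] (revSphImage K₁ ω))
    {q : ℝ} (hq : q = (1 + θ) / (1 - θ)) :
    volume (Ioo (0 : ℝ) 1 • revSphImage K₁ ω) ≤ ENNReal.ofReal (q ^ (4 * n + 1)) *
      ∫⁻ x in (Ioo (0 : ℝ) 1 • revSphImage K₀ ω) ∩ interior C,
        ENNReal.ofReal (gK K₀ x / gK K₁ x) := by
  obtain ⟨κ, hκ⟩ := exists_kappa h₀.dim w hw
  have c1 := (h₁.cell_single hc hcC hθ hθ1 hω hωc κ hκ hq).1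
  have c0 := (h₀.cell_single hc hcC hθ hθ1 hω hωc κ hκ hq).2
  rw [hS] at c0
  set X := κ * μH[((n : ℝ) - 1)] (revSphImage K₁ ω)
  clear_value X
  have ha0 := h₀.aK_pos hc hcC
  have ha1 := h₁.aK_pos hc hcC
  set a₀ := aK K₀ w
  set a₁ := aK K₁ w
  have hq0 : 0 < q := by rw [hq]; exact div_pos (by linarith) (by linarith)
  set D := Ioo (0 : ℝ) 1 • revSphImage K₀ ω with hD
  have hDm : MeasurableSet D := measurable_cone (h₀.T_compact hc hcC hθ hθ1 hω hωc)
  have hint : ENNReal.ofReal (a₁ / (q * a₀)) * volume (D ∩ interior C) ≤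
      ∫⁻ x in D ∩ interior C, ENNReal.ofReal (gK K₀ x / gK K₁ x) := by
    rw [← setLIntegral_const]
    refine setLIntegral_mono' (hDm.inter isOpen_interior.measurableSet) fun x hx => ?_
    apply ENNReal.ofReal_le_ofReal
    obtain ⟨hxD, hxC⟩ := hx
    have g1 := h₁.gK_pos hxC
    have hs1 := h₁.aK_le hc hcC (h₁.inv_smul_mem hxC)
    obtain ⟨t, ht, y, hy, rfl⟩ := mem_smul.1 hxD
    have hb := h₀.T_bound hc hcC hθ hθ1 hω hy
    rw [← hq] at hb
    obtain ⟨hyK, u, hu, hn⟩ := h₀.rev_mem hy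
    have gy := h₀.cone_gK (hωO hu) hyK hn
    rw [CClose.gK_smul ht.1.le, gy, mul_one]
    rw [inner_smul_left, inner_smul_left] at hs1
    simp only [conj_trivial] at hs1
    change a₁ ≤ _ at hs1
    change _ ≤ q * a₀ at hb
    rw [div_le_div_iff₀ (by positivity) g1]
    rw [← div_eq_inv_mul, le_div_iff₀ g1] at hs1
    have := ht.1
    nlinarith
  calc volume (Ioo (0 : ℝ) 1 • revSphImage K₁ ω) ≤ ENNReal.ofReal (q ^ (2 * n) * a₁) * X := c1
    _ = ENNReal.ofReal (q ^ (2 * n) * (a₁ / a₀)) * (ENNReal.ofReal a₀ * X) := by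
        rw [← mul_assoc, ← ENNReal.ofReal_mul (by positivity)]
        congr 2
        field_simp
    _ ≤ ENNReal.ofReal (q ^ (2 * n) * (a₁ / a₀)) * (ENNReal.ofReal (q ^ (2 * n)) * volume D) := by
        gcongr
    _ = ENNReal.ofReal (q ^ (4 * n + 1)) *
          (ENNReal.ofReal (a₁ / (q * a₀)) * volume (D ∩ interior C)) := by
        rw [← h₀.vol_inter (h₀.cone_sub (ω := ω)), ← mul_assoc, ← mul_assoc,
          ← ENNReal.ofReal_mul (by positivity), ← ENNReal.ofReal_mul (by positivity)]
        congr 2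
        field_simp
        ring
    _ ≤ _ := by gcongr

end cells

section summation

variable {n : ℕ} {C K K₀ K₁ : Set (EuclideanSpace ℝ (Fin n))}

lemma CClose.cone_touch (h : CClose C K) {ω : Set (EuclideanSpace ℝ (Fin n))} (hω : ω ⊆ OmC C)
    {x : EuclideanSpace ℝ (Fin n)} (hx : x ∈ Ioo (0 : ℝ) 1 • revSphImage K ω) :
    gK K x < 1 ∧ ∃ p ∈ antiP K, gK K x = ⟪x, p⟫ ∧ (-‖p‖⁻¹) • p ∈ ω := by
  obtain ⟨t, ht, y, hy, rfl⟩ := mem_smul.1 hx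
  obtain ⟨hyf, u, hu, hu1, hn⟩ := hy
  have hyK := h.K_closed.frontier_subset hyf
  have gy := h.cone_gK (hω hu) hyK hn
  obtain ⟨hneg, hp⟩ := h.rev_antiP (hω hu) hyK hn
  rw [CClose.gK_smul ht.1.le, gy, mul_one]
  refine ⟨ht.2, _, hp, ?_, ?_⟩
  · rw [inner_smul_left, inner_smul_right, inv_mul_cancel₀ hneg.ne]; simp
  · convert hu
    rw [norm_smul, hu1, mul_one, norm_inv, Real.norm_of_nonpos hneg.le, inv_inv, smul_smul,
      neg_neg, mul_inv_cancel₀ hneg.ne, one_smul]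

lemma CClose.cone_disj (h : CClose C K) {ω ω' : Set (EuclideanSpace ℝ (Fin n))} (hω : ω ⊆ OmC C)
    (hω' : ω' ⊆ OmC C) (hd : Disjoint ω ω') {x : EuclideanSpace ℝ (Fin n)}
    (hxC : x ∈ interior C) (hdx : DifferentiableAt ℝ (gK K) x)
    (hx : x ∈ Ioo (0 : ℝ) 1 • revSphImage K ω) (hx' : x ∈ Ioo (0 : ℝ) 1 • revSphImage K ω') :
    False := by
  obtain ⟨-, p, hp, hxp, hpo⟩ := h.cone_touch hω hx
  obtain ⟨-, p', hp', hxp', hpo'⟩ := h.cone_touch hω' hx'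
  have := h.touching_unique hxC hdx hp hp' hxp hxp'
  subst this
  exact Set.disjoint_left.1 hd hpo hpo'

lemma sum_ineq_q (h₀ : CClose C K₀) (h₁ : CClose C K₁)
    (hS : ∀ ω : Set (EuclideanSpace ℝ (Fin n)), MeasurableSet ω → ω ⊆ OmC C →
      μH[((n : ℝ) - 1)] (revSphImage K₀ ω) = μH[((n : ℝ) - 1)] (revSphImage K₁ ω))
    {θ : ℝ} (hθ : 0 < θ) (hθ1 : θ < 1) :
    volume (interior C \ K₁) ≤ ENNReal.ofReal (((1 + θ) / (1 - θ)) ^ (4 * n + 1)) *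
      ∫⁻ x in interior C \ K₀, ENNReal.ofReal (gK K₀ x / gK K₁ x) := by
  have hcoer : ∀ u : EuclideanSpace ℝ (Fin n), ∃ c : ℝ, 0 < c ∧ (u ∈ OmC C →
      ∀ y ∈ C, c * ‖y‖ ≤ ⟪y, -u⟫) := by
    intro u
    by_cases hu : u ∈ OmC C
    · obtain ⟨c, hc, h⟩ := OmC_coercive hu
      exact ⟨c, hc, fun _ => h⟩
    · exact ⟨1, one_pos, fun h => absurd h hu⟩
  choose c hc hcC using hcoer
  obtain ⟨t, htO, htc, htcov⟩ := TopologicalSpace.countable_cover_nhdsWithin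
    (s := OmC C) (f := fun u => Metric.closedBall u (c u * θ)) (fun u _ =>
      mem_nhdsWithin_of_mem_nhds (Metric.closedBall_mem_nhds _ (mul_pos (hc u) hθ)))
  obtain ⟨p, hp⟩ := h₀.antiP_nonempty
  have htne : t.Nonempty := by
    have := htcov (h₀.normal_mem hp)
    simp only [mem_iUnion] at this
    obtain ⟨u, hu, -⟩ := this
    exact ⟨u, hu⟩
  obtain ⟨e, rfl⟩ := htc.exists_eq_range htne
  have heO : ∀ j, e j ∈ OmC C := fun j => htO (mem_range_self j)
  set B : ℕ → Set (EuclideanSpace ℝ (Fin n)) := fun j => Metric.closedBall (e j) (c (e j) * θ) with hB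
  have hcov : ∀ u ∈ OmC C, ∃ j, u ∈ B j := by
    intro u hu
    have := htcov hu
    rw [biUnion_range] at this
    exact mem_iUnion.1 this
  have hUo : ∀ j : ℕ, IsOpen (interior {x : EuclideanSpace ℝ (Fin n) | ∀ y ∈ C, ⟪x, y⟫ ≤ 0} \
      ⋃ i ∈ Iio j, B i) := fun j =>
    isOpen_interior.sdiff ((finite_Iio j).isClosed_biUnion fun i _ => Metric.isClosed_closedBall)
  choose F hFc hFs hFU hFm using fun j => (hUo j).exists_iUnion_isClosed
  set ω : ℕ → ℕ → Set (EuclideanSpace ℝ (Fin n)) := fun j k =>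
    Metric.sphere 0 1 ∩ F j k ∩ B j with hω
  have hωc : ∀ j k, IsCompact (ω j k) := fun j k =>
    ((isCompact_sphere _ _).inter_right (hFc j k)).inter_right Metric.isClosed_closedBall
  have hωB : ∀ j k, ω j k ⊆ B j := fun j k => inter_subset_right
  have hωO : ∀ j k, ω j k ⊆ OmC C := fun j k x hx => ⟨hx.1.1, (hFs j k hx.1.2).1⟩
  have hωm : ∀ j, Monotone (ω j) := fun j k l hkl => by
    have := hFm j hkl
    simp only [hω]
    gcongr
  have hωd : ∀ i j, i < j → ∀ k l, Disjoint (ω i k) (ω j l) := by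
    intro i j hij k l
    rw [Set.disjoint_left]
    intro x hx hx'
    exact (hFs j l hx'.1.2).2 (mem_biUnion hij (hωB i k hx))
  have hωU : ∀ u ∈ OmC C, ∃ j k, u ∈ ω j k := by
    classical
    intro u hu
    have hj := hcov u hu
    have hmem : u ∈ ⋃ k, F (Nat.find hj) k := by
      rw [hFU]
      refine ⟨hu.2, ?_⟩
      simp only [mem_iUnion, not_exists, mem_Iio]
      intro i hi
      exact Nat.find_min hj hi
    obtain ⟨k, hk⟩ := mem_iUnion.1 hmem
    exact ⟨Nat.find hj, k, ⟨hu.1, hk⟩, Nat.find_spec hj⟩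
  set q := (1 + θ) / (1 - θ) with hq
  set f : EuclideanSpace ℝ (Fin n) → ENNReal := fun x => ENNReal.ofReal (gK K₀ x / gK K₁ x) with hf
  set D₀ : ℕ → Set (EuclideanSpace ℝ (Fin n)) :=
    fun j => ⋃ k, ((Ioo (0 : ℝ) 1 • revSphImage K₀ (ω j k)) ∩ interior C) with hD₀
  set D₁ : ℕ → Set (EuclideanSpace ℝ (Fin n)) :=
    fun j => ⋃ k, (Ioo (0 : ℝ) 1 • revSphImage K₁ (ω j k)) with hD₁
  have hcell : ∀ j, volume (D₁ j) ≤ ENNReal.ofReal (q ^ (4 * n + 1)) * ∫⁻ x in D₀ j, f x := by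
    intro j
    have hmono : Monotone fun k => Ioo (0 : ℝ) 1 • revSphImage K₁ (ω j k) := by
      intro k l hkl
      refine smul_subset_smul_left ?_
      rintro x ⟨hx, u, hu, hux⟩
      exact ⟨hx, u, hωm j hkl hu, hux⟩
    rw [hD₁]
    simp only
    rw [hmono.measure_iUnion]
    refine iSup_le fun k => ?_
    refine (cell_ineq h₀ h₁ (w := -e j) (c := c (e j)) (θ := θ) (ω := ω j k) ?_ (hc _)
      (hcC _ (heO j)) hθ hθ1 ?_ (hωc j k) (hωO j k)
      (hS _ (hωc j k).measurableSet (hωO j k)) hq).trans ?_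
    · rw [norm_neg]; exact mem_sphere_zero_iff_norm.1 (heO j).1
    · rw [neg_neg]; exact hωB j k
    · gcongr
      exact subset_iUnion (fun k => (Ioo (0 : ℝ) 1 • revSphImage K₀ (ω j k)) ∩ interior C) k
  have hD₀m : ∀ j, MeasurableSet (D₀ j) := fun j => MeasurableSet.iUnion fun k =>
    (measurable_cone (h₀.T_compact (w := -e j) (hc _) (hcC _ (heO j)) hθ hθ1
      (by rw [neg_neg]; exact hωB j k) (hωc j k))).inter isOpen_interior.measurableSet
  have hdisj : Pairwise (Function.onFun (AEDisjoint volume) D₀) := by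
    have key : ∀ i j, i < j → AEDisjoint volume (D₀ i) (D₀ j) := by
      intro i j hij
      refine measure_mono_null (t := {x | ¬ (x ∈ interior C → DifferentiableAt ℝ (gK K₀) x)}) ?_
        (ae_iff.1 h₀.gK_ae_diff)
      rintro x ⟨hx, hx'⟩ hdx
      obtain ⟨k, hk⟩ := mem_iUnion.1 hx
      obtain ⟨l, hl⟩ := mem_iUnion.1 hx'
      exact h₀.cone_disj (hωO i k) (hωO j l) (hωd i j hij k l) hk.2 (hdx hk.2) hk.1 hl.1
    intro i j hij
    rcases lt_or_gt_of_ne hij with h | h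
    · exact key i j h
    · exact (key j i h).symm
  calc volume (interior C \ K₁) ≤ volume (⋃ j, D₁ j) := by
        refine measure_mono (h₁.cover.trans ?_)
        intro x hx
        obtain ⟨t, ht, y, ⟨hyf, u, hu, hn⟩, rfl⟩ := mem_smul.1 hx
        obtain ⟨j, k, hjk⟩ := hωU u hu
        exact mem_iUnion.2 ⟨j, mem_iUnion.2 ⟨k, mem_smul.2 ⟨t, ht, y, ⟨hyf, u, hjk, hn⟩, rfl⟩⟩⟩
    _ ≤ ∑' j, volume (D₁ j) := measure_iUnion_le _
    _ ≤ ∑' j, ENNReal.ofReal (q ^ (4 * n + 1)) * ∫⁻ x in D₀ j, f x := ENNReal.tsum_le_tsum hcell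
    _ = ENNReal.ofReal (q ^ (4 * n + 1)) * ∫⁻ x in ⋃ j, D₀ j, f x := by
        rw [ENNReal.tsum_mul_left, lintegral_iUnion₀ (fun j => (hD₀m j).nullMeasurableSet) hdisj]
    _ ≤ _ := by
        gcongr
        refine iUnion_subset fun j => iUnion_subset fun k => ?_
        rintro x ⟨hx, hxC⟩
        exact ⟨hxC, (h₀.notMem_iff (interior_subset hxC)).2 (h₀.cone_touch (hωO j k) hx).1⟩

lemma sum_ineq (h₀ : CClose C K₀) (h₁ : CClose C K₁)
    (hS : ∀ ω : Set (EuclideanSpace ℝ (Fin n)), MeasurableSet ω → ω ⊆ OmC C →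
      μH[((n : ℝ) - 1)] (revSphImage K₀ ω) = μH[((n : ℝ) - 1)] (revSphImage K₁ ω)) :
    volume (interior C \ K₁) ≤
      ∫⁻ x in interior C \ K₀, ENNReal.ofReal (gK K₀ x / gK K₁ x) := by
  have hev : ∀ᶠ θ : ℝ in nhdsWithin 0 (Ioi 0), volume (interior C \ K₁) ≤
      ENNReal.ofReal (((1 + θ) / (1 - θ)) ^ (4 * n + 1)) *
      ∫⁻ x in interior C \ K₀, ENNReal.ofReal (gK K₀ x / gK K₁ x) := by
    filter_upwards [Ioo_mem_nhdsGT (one_pos : (0 : ℝ) < 1)] with θ hθ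
    exact sum_ineq_q h₀ h₁ hS hθ.1 hθ.2
  have hlim : Filter.Tendsto (fun θ : ℝ => ENNReal.ofReal (((1 + θ) / (1 - θ)) ^ (4 * n + 1)))
      (nhdsWithin 0 (Ioi 0)) (nhds 1) := by
    have hc : ContinuousAt (fun θ : ℝ => ((1 + θ) / (1 - θ)) ^ (4 * n + 1)) 0 := by
      refine ContinuousAt.pow (ContinuousAt.div ?_ ?_ (by norm_num)) _ <;> fun_prop
    have h2 := ENNReal.tendsto_ofReal hc.tendsto
    simp only [add_zero, sub_zero, div_one, one_pow, ENNReal.ofReal_one] at h2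
    exact h2.mono_left nhdsWithin_le_nhds
  have := ge_of_tendsto (ENNReal.Tendsto.mul_const hlim (Or.inl one_ne_zero)) hev
  rwa [one_mul] at this

end summation

section final

variable {n : ℕ} {C K K₀ K₁ : Set (EuclideanSpace ℝ (Fin n))}

/-- The gauge, extended by zero. -/
noncomputable def gC (C K : Set (EuclideanSpace ℝ (Fin n))) : EuclideanSpace ℝ (Fin n) → ℝ :=
  (interior C).indicator (gK K)

lemma gC_eq {x : EuclideanSpace ℝ (Fin n)} (hx : x ∈ interior C) : gC C K x = gK K x :=
  indicator_of_mem hx _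

lemma CClose.gK_cont (h : CClose C K) : ContinuousOn (gK K) (interior C) :=
  h.gK_concave.continuousOn isOpen_interior

lemma CClose.gC_meas (h : CClose C K) : Measurable (gC C K) := by
  classical
  have := h.gK_cont.measurable_piecewise (g := fun _ => (0 : ℝ)) continuousOn_const
    isOpen_interior.measurableSet
  rw [gC, ← piecewise_eq_indicator]
  exact this

lemma CClose.gC_smul (h : CClose C K) {x : EuclideanSpace ℝ (Fin n)} (hx : x ∈ interior C) {t : ℝ}
    (ht : 0 < t) : gC C K (t • x) = t * gC C K x := by
  rw [gC_eq hx, gC_eq (h.smul_mem_interior hx ht), CClose.gK_smul ht.le]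

lemma CClose.polar (h : CClose C K) {f : EuclideanSpace ℝ (Fin n) → ENNReal} (hf : Measurable f)
    (hom : ∀ x ∈ interior C, ∀ t : ℝ, 0 < t → f (t • x) = f x) :
    ∫⁻ x in interior C \ K, f x =
      ∫⁻ s : Metric.sphere (0 : EuclideanSpace ℝ (Fin n)) 1 in {s | s.1 ∈ interior C},
        f s * ENNReal.ofReal ((gC C K s)⁻¹ ^ n / n)
        ∂(volume : Measure (EuclideanSpace ℝ (Fin n))).toSphere := by
  obtain ⟨k, rfl⟩ : ∃ k, n = k + 1 := ⟨n - 1, by have := h.dim; omega⟩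
  have hms : MeasurableSet (interior C \ K) :=
    isOpen_interior.measurableSet.diff h.K_closed.measurableSet
  set G := (interior C \ K).indicator f with hG
  have hGm : Measurable G := hf.indicator hms
  have hms2 : MeasurableSet {s : Metric.sphere (0 : EuclideanSpace ℝ (Fin (k + 1))) 1 |
      s.1 ∈ interior C} := measurable_subtype_coe isOpen_interior.measurableSet
  have hfr : Module.finrank ℝ (EuclideanSpace ℝ (Fin (k + 1))) - 1 = k := by simp
  have hmp := (volume : Measure (EuclideanSpace ℝ (Fin (k + 1)))).measurePreserving_homeomorphUnitSphereProd
  rw [hfr] at hmp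
  set e := homeomorphUnitSphereProd (EuclideanSpace ℝ (Fin (k + 1))) with he
  rw [← lintegral_indicator hms, ← hG, ← lintegral_indicator hms2]
  calc ∫⁻ x, G x = ∫⁻ x : ({(0)}ᶜ : Set (EuclideanSpace ℝ (Fin (k + 1)))), G x
          ∂(Measure.comap Subtype.val volume) := by
        rw [lintegral_subtype_comap (measurableSet_singleton _).compl fun x => G x,
          restrict_compl_singleton]
    _ = ∫⁻ z, G (e.symm z) ∂((volume : Measure (EuclideanSpace ℝ (Fin (k + 1)))).toSphere.prod
          (Measure.volumeIoiPow k)) := by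
        rw [← hmp.lintegral_comp (f := fun z => G (e.symm z))
          (hGm.comp (measurable_subtype_coe.comp e.symm.measurable))]
        simp
    _ = ∫⁻ s, ∫⁻ r, G (e.symm (s, r)) ∂(Measure.volumeIoiPow k)
          ∂(volume : Measure (EuclideanSpace ℝ (Fin (k + 1)))).toSphere := by
        rw [lintegral_prod]
        exact (hGm.comp (measurable_subtype_coe.comp e.symm.measurable)).aemeasurable
    _ = _ := by
        refine lintegral_congr fun s => ?_
        have hes : ∀ r, (e.symm (s, r) : EuclideanSpace ℝ (Fin (k + 1))) = r.1 • s.1 := fun r => by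
          simp [he]
        simp only [hes]
        by_cases hs : s.1 ∈ interior C
        · rw [indicator_of_mem (by exact hs)]
          have hg := h.gK_pos hs
          have e1 : ∀ r : Ioi (0 : ℝ), G (r.1 • s.1) =
              (Iio (⟨(gK K s)⁻¹, inv_pos.2 hg⟩ : Ioi (0 : ℝ))).indicator (fun _ => f s) r := by
            intro r
            have hr : (0 : ℝ) < r.1 := r.2
            have hrs := h.smul_mem_interior hs hr
            have hiff : r.1 • s.1 ∈ interior C \ K ↔
                r ∈ Iio (⟨(gK K s)⁻¹, inv_pos.2 hg⟩ : Ioi (0 : ℝ)) := by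
              rw [mem_sdiff, h.notMem_iff (interior_subset hrs), CClose.gK_smul hr.le, mem_Iio,
                ← Subtype.coe_lt_coe]
              simp only [hrs, true_and]
              rw [← one_div, lt_div_iff₀ hg]
            by_cases hm : r.1 • s.1 ∈ interior C \ K
            · rw [hG, indicator_of_mem hm, indicator_of_mem (hiff.1 hm), hom _ hs _ hr]
            · rw [hG, indicator_of_notMem hm, indicator_of_notMem (fun h => hm (hiff.2 h))]
          simp only [e1]
          rw [lintegral_indicator_const measurableSet_Iio, Measure.volumeIoiPow_apply_Iio, gC_eq hs]
          push_cast
          rfl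
        · rw [indicator_of_notMem (by exact hs)]
          have e1 : ∀ r : Ioi (0 : ℝ), G (r.1 • s.1) = 0 := by
            intro r
            have hr : (0 : ℝ) < r.1 := r.2
            refine indicator_of_notMem (fun hm => hs ?_) _
            have := h.smul_mem_interior hm.1 (inv_pos.2 hr)
            rwa [smul_smul, inv_mul_cancel₀ hr.ne', one_smul] at this
          simp only [e1, lintegral_zero]

lemma elem_ineq {k : ℕ} {a b : ℝ} (ha : 0 < a) (hb : 0 < b) :
    b * a ^ k + a * b ^ k ≤ a ^ (k + 1) + b ^ (k + 1) := by
  rw [pow_succ, pow_succ]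
  rcases le_total a b with h | h
  · have := pow_le_pow_left₀ ha.le h k
    nlinarith [mul_nonneg (sub_nonneg.2 h) (sub_nonneg.2 this)]
  · have := pow_le_pow_left₀ hb.le h k
    nlinarith [mul_nonneg (sub_nonneg.2 h) (sub_nonneg.2 this)]

lemma elem_eq {k : ℕ} (hk : k ≠ 0) {a b : ℝ} (ha : 0 < a) (hb : 0 < b)
    (he : b * a ^ k + a * b ^ k = a ^ (k + 1) + b ^ (k + 1)) : a = b := by
  rw [pow_succ, pow_succ] at he
  by_contra hne
  rcases lt_or_gt_of_ne hne with h | h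
  · have := pow_lt_pow_left₀ h ha.le hk
    nlinarith [mul_pos (sub_pos.2 h) (sub_pos.2 this)]
  · have := pow_lt_pow_left₀ h hb.le hk
    nlinarith [mul_pos (sub_pos.2 h) (sub_pos.2 this)]

lemma gauge_eq (h₀ : CClose C K₀) (h₁ : CClose C K₁)
    (hS : ∀ ω : Set (EuclideanSpace ℝ (Fin n)), MeasurableSet ω → ω ⊆ OmC C →
      μH[((n : ℝ) - 1)] (revSphImage K₀ ω) = μH[((n : ℝ) - 1)] (revSphImage K₁ ω)) :
    ∀ x ∈ interior C, gK K₀ x = gK K₁ x := by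
  obtain ⟨k, rfl⟩ : ∃ k, n = k + 1 := ⟨n - 1, by have := h₀.dim; omega⟩
  have hk : k ≠ 0 := by have := h₀.dim; omega
  have s1 := sum_ineq h₀ h₁ hS
  have s2 := sum_ineq h₁ h₀ fun ω hm hO => (hS ω hm hO).symm
  have hm0 := h₀.gC_meas
  have hm1 := h₁.gC_meas
  set σ := (volume : Measure (EuclideanSpace ℝ (Fin (k + 1)))).toSphere with hσ
  set A : Set (Metric.sphere (0 : EuclideanSpace ℝ (Fin (k + 1))) 1) := {s | s.1 ∈ interior C} with hA
  have hAm : MeasurableSet A := measurable_subtype_coe isOpen_interior.measurableSet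
  have hvol : ∀ K, CClose C K → volume (interior C \ K) =
      ∫⁻ s in A, ENNReal.ofReal ((gC C K s)⁻¹ ^ (k + 1) / ((k + 1 : ℕ) : ℝ)) ∂σ := by
    intro K h
    have := h.polar (f := fun _ => 1) measurable_const (fun _ _ _ _ => rfl)
    simp only [one_mul] at this
    rw [← this, setLIntegral_one]
  have hmix : ∀ K K', CClose C K → CClose C K' →
      ∫⁻ x in interior C \ K, ENNReal.ofReal (gK K x / gK K' x) =
      ∫⁻ s in A, ENNReal.ofReal ((gC C K' s)⁻¹ * (gC C K s)⁻¹ ^ k / ((k + 1 : ℕ) : ℝ)) ∂σ := by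
    intro K K' h h'
    have hm : MeasurableSet (interior C \ K) :=
      isOpen_interior.measurableSet.diff h.K_closed.measurableSet
    have e1 : ∫⁻ x in interior C \ K, ENNReal.ofReal (gK K x / gK K' x) =
        ∫⁻ x in interior C \ K, ENNReal.ofReal (gC C K x / gC C K' x) := by
      refine setLIntegral_congr_fun hm fun x hx => ?_
      simp only [gC_eq hx.1]
    rw [e1, h.polar (f := fun x => ENNReal.ofReal (gC C K x / gC C K' x))
      (h.gC_meas.div h'.gC_meas).ennreal_ofReal]
    · refine setLIntegral_congr_fun hAm fun s hs => ?_
      have hs' : s.1 ∈ interior C := hs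
      have g := h.gK_pos hs'
      have g' := h'.gK_pos hs'
      simp only [gC_eq hs']
      rw [← ENNReal.ofReal_mul (by positivity)]
      congr 1
      rw [pow_succ]
      field_simp
    · intro x hx t ht
      rw [h.gC_smul hx ht, h'.gC_smul hx ht, mul_div_mul_left _ _ ht.ne']
  rw [hvol K₁ h₁, hmix K₀ K₁ h₀ h₁] at s1
  rw [hvol K₀ h₀, hmix K₁ K₀ h₁ h₀] at s2
  have f0 : volume (interior C \ K₀) ≠ ⊤ :=
    ((measure_mono (sdiff_subset_sdiff_left interior_subset)).trans_lt h₀.vol_fin).ne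
  have f1 : volume (interior C \ K₁) ≠ ⊤ :=
    ((measure_mono (sdiff_subset_sdiff_left interior_subset)).trans_lt h₁.vol_fin).ne
  rw [hvol K₀ h₀] at f0
  rw [hvol K₁ h₁] at f1
  set a₀ : Metric.sphere (0 : EuclideanSpace ℝ (Fin (k + 1))) 1 → ENNReal := fun s =>
    ENNReal.ofReal ((gC C K₀ s)⁻¹ ^ (k + 1) / ((k + 1 : ℕ) : ℝ)) with ha₀
  set a₁ : Metric.sphere (0 : EuclideanSpace ℝ (Fin (k + 1))) 1 → ENNReal := fun s =>
    ENNReal.ofReal ((gC C K₁ s)⁻¹ ^ (k + 1) / ((k + 1 : ℕ) : ℝ)) with ha₁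
  set b₀ : Metric.sphere (0 : EuclideanSpace ℝ (Fin (k + 1))) 1 → ENNReal := fun s =>
    ENNReal.ofReal ((gC C K₁ s)⁻¹ * (gC C K₀ s)⁻¹ ^ k / ((k + 1 : ℕ) : ℝ)) with hb₀
  set b₁ : Metric.sphere (0 : EuclideanSpace ℝ (Fin (k + 1))) 1 → ENNReal := fun s =>
    ENNReal.ofReal ((gC C K₀ s)⁻¹ * (gC C K₁ s)⁻¹ ^ k / ((k + 1 : ℕ) : ℝ)) with hb₁
  have hn0 : Measurable fun s : Metric.sphere (0 : EuclideanSpace ℝ (Fin (k + 1))) 1 =>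
    gC C K₀ s := hm0.comp measurable_subtype_coe
  have hn1 : Measurable fun s : Metric.sphere (0 : EuclideanSpace ℝ (Fin (k + 1))) 1 =>
    gC C K₁ s := hm1.comp measurable_subtype_coe
  have ma₀ : Measurable a₀ := by fun_prop
  have ma₁ : Measurable a₁ := by fun_prop
  have mb₀ : Measurable b₀ := by fun_prop
  have mb₁ : Measurable b₁ := by fun_prop
  have hbs : ∀ s ∈ A, b₀ s + b₁ s = ENNReal.ofReal (((gC C K₁ s)⁻¹ * (gC C K₀ s)⁻¹ ^ k +
      (gC C K₀ s)⁻¹ * (gC C K₁ s)⁻¹ ^ k) / ((k + 1 : ℕ) : ℝ)) := by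
    intro s hs
    have g0 := h₀.gK_pos (x := s.1) hs
    have g1 := h₁.gK_pos (x := s.1) hs
    rw [← gC_eq (C := C) (x := s.1) hs] at g0 g1
    rw [hb₀, hb₁, add_div, ENNReal.ofReal_add (by positivity) (by positivity)]
  have has : ∀ s ∈ A, a₀ s + a₁ s = ENNReal.ofReal (((gC C K₀ s)⁻¹ ^ (k + 1) +
      (gC C K₁ s)⁻¹ ^ (k + 1)) / ((k + 1 : ℕ) : ℝ)) := by
    intro s hs
    have g0 := h₀.gK_pos (x := s.1) hs
    have g1 := h₁.gK_pos (x := s.1) hs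
    rw [← gC_eq (C := C) (x := s.1) hs] at g0 g1
    rw [ha₀, ha₁, add_div, ENNReal.ofReal_add (by positivity) (by positivity)]
  have hle : ∀ s ∈ A, b₀ s + b₁ s ≤ a₀ s + a₁ s := by
    intro s hs
    have g0 := h₀.gK_pos (x := s.1) hs
    have g1 := h₁.gK_pos (x := s.1) hs
    rw [← gC_eq (C := C) (x := s.1) hs] at g0 g1
    rw [hbs s hs, has s hs]
    refine ENNReal.ofReal_le_ofReal (div_le_div_of_nonneg_right ?_ (by positivity))
    exact elem_ineq (inv_pos.2 g0) (inv_pos.2 g1)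
  have hsumle : ∫⁻ s in A, (a₀ s + a₁ s) ∂σ ≤ ∫⁻ s in A, (b₀ s + b₁ s) ∂σ := by
    rw [lintegral_add_left ma₀, lintegral_add_left mb₀, add_comm]
    exact add_le_add s1 s2
  have hafin : ∫⁻ s in A, (a₀ s + a₁ s) ∂σ ≠ ⊤ := by
    rw [lintegral_add_left ma₀]
    exact ENNReal.add_ne_top.2 ⟨f0, f1⟩
  have hle' : (fun s => b₀ s + b₁ s) ≤ᵐ[σ.restrict A] fun s => a₀ s + a₁ s :=
    (ae_restrict_iff' hAm).2 (Filter.Eventually.of_forall hle)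
  have hae := ae_eq_of_ae_le_of_lintegral_le hle'
    (ne_top_of_le_ne_top hafin (lintegral_mono_ae hle')) (by fun_prop) hsumle
  have hg : ∀ᵐ s : Metric.sphere (0 : EuclideanSpace ℝ (Fin (k + 1))) 1 ∂(σ.restrict A),
      gC C K₀ s = gC C K₁ s := by
    filter_upwards [hae, ae_restrict_mem hAm] with s he hs
    have g0 := h₀.gK_pos (x := s.1) hs
    have g1 := h₁.gK_pos (x := s.1) hs
    rw [← gC_eq (C := C) (x := s.1) hs] at g0 g1
    rw [hbs s hs, has s hs, ENNReal.ofReal_eq_ofReal_iff (by positivity) (by positivity),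
      div_left_inj' (by positivity)] at he
    exact inv_injective (elem_eq hk (inv_pos.2 g0) (inv_pos.2 g1) he)
  -- the bad set is null
  set N : Set (EuclideanSpace ℝ (Fin (k + 1))) := {x | gC C K₀ x ≠ gC C K₁ x} with hN
  have hNm : MeasurableSet N := (measurableSet_eq_fun hm0 hm1).compl
  have hnull : volume (N ∩ (interior C \ K₀)) = 0 := by
    rw [← Measure.restrict_apply hNm, ← lintegral_indicator_one hNm, h₀.polar]
    · refine (lintegral_congr_ae ?_).trans lintegral_zero
      filter_upwards [hg] with s hs
      rw [indicator_of_notMem (by simpa [hN] using hs), zero_mul]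
    · exact measurable_one.indicator hNm
    · intro x hx t ht
      have : t • x ∈ N ↔ x ∈ N := by
        simp only [hN, mem_ofPred_eq]
        rw [h₀.gC_smul hx ht, h₁.gC_smul hx ht, Ne, mul_right_inj' ht.ne']
      by_cases hx : x ∈ N
      · rw [indicator_of_mem hx, indicator_of_mem (this.2 hx)]; rfl
      · rw [indicator_of_notMem hx, indicator_of_notMem (fun h => hx (this.1 h))]
  intro x hx
  by_contra hne
  have g0 := h₀.gK_pos hx
  set t := (2 * gK K₀ x)⁻¹ with ht
  have ht0 : 0 < t := by positivity
  have htx := h₀.smul_mem_interior hx ht0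
  have hopen : IsOpen (interior C ∩ (fun y => gK K₀ y - gK K₁ y) ⁻¹' {0}ᶜ ∩ K₀ᶜ) :=
    ((h₀.gK_cont.sub h₁.gK_cont).isOpen_inter_preimage isOpen_interior
      isClosed_singleton.isOpen_compl).inter h₀.K_closed.isOpen_compl
  have hmem : t • x ∈ interior C ∩ (fun y => gK K₀ y - gK K₁ y) ⁻¹' {0}ᶜ ∩ K₀ᶜ := by
    refine ⟨⟨htx, ?_⟩, ?_⟩
    · simp only [mem_preimage, mem_compl_iff, mem_singleton_iff]
      rw [CClose.gK_smul ht0.le, CClose.gK_smul ht0.le, ← mul_sub]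
      exact mul_ne_zero ht0.ne' (sub_ne_zero.2 hne)
    · rw [mem_compl_iff, h₀.notMem_iff (interior_subset htx), CClose.gK_smul ht0.le, ht]
      have : (2 * gK K₀ x)⁻¹ * gK K₀ x = 1 / 2 := by field_simp
      rw [this]; norm_num
  refine (hopen.measure_pos volume ⟨_, hmem⟩).ne' (measure_mono_null ?_ hnull)
  rintro y ⟨⟨hyC, hy⟩, hyK⟩
  refine ⟨?_, hyC, hyK⟩
  simp only [hN, mem_ofPred_eq]
  rw [gC_eq hyC, gC_eq hyC]
  exact sub_ne_zero.1 hy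

lemma CClose.K_eq (h : CClose C K) : K = closure (interior K) := by
  have hne : (interior K).Nonempty := by
    by_contra hemp
    rw [not_nonempty_iff_eq_empty] at hemp
    have h0 : volume K = 0 := by
      have := h.K_conv.addHaar_frontier volume
      rwa [h.K_closed.frontier_eq, hemp, sdiff_empty] at this
    have hle : volume C < ⊤ := by
      refine (measure_mono (t := (C \ K) ∪ K) ?_).trans_lt ((measure_union_le _ _).trans_lt ?_)
      · intro x hx
        by_cases hk : x ∈ K
        · exact Or.inr hk
        · exact Or.inl ⟨hx, hk⟩
      · rw [h0, add_zero]; exact h.vol_fin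
    have htwo : (2 : ℝ) • C ⊆ C := by
      rintro _ ⟨x, hx, rfl⟩
      exact h.C_cone x hx 2 (by norm_num)
    have h2 := measure_mono (μ := volume) htwo
    have hdim := h.dim
    rw [Measure.addHaar_smul_of_nonneg _ (by norm_num)] at h2
    have hpos : volume C ≠ 0 :=
      ((isOpen_interior.measure_pos volume h.C_int).trans_le (measure_mono interior_subset)).ne'
    have h3 : (1 : ENNReal) < ENNReal.ofReal (2 ^ Module.finrank ℝ (EuclideanSpace ℝ (Fin n))) := by
      rw [ENNReal.one_lt_ofReal]
      exact one_lt_pow₀ (by norm_num) (by simp; omega)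
    have h4 := ENNReal.mul_lt_mul_left hpos hle.ne h3
    rw [one_mul] at h4
    exact absurd h2 (not_le.2 h4)
  rw [h.K_conv.closure_interior_eq_closure_of_nonempty_interior hne, h.K_closed.closure_eq]

lemma CClose.unique (h₀ : CClose C K₀) (h₁ : CClose C K₁)
    (hS : ∀ ω : Set (EuclideanSpace ℝ (Fin n)), MeasurableSet ω → ω ⊆ OmC C →
      μH[((n : ℝ) - 1)] (revSphImage K₀ ω) = μH[((n : ℝ) - 1)] (revSphImage K₁ ω)) :
    K₀ = K₁ := by
  have hg := gauge_eq h₀ h₁ hS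
  have key : ∀ K K', CClose C K → CClose C K' → (∀ x ∈ interior C, gK K x = gK K' x) →
      K ⊆ K' := by
    intro K K' h h' hg
    rw [h.K_eq]
    refine closure_minimal (fun x hx => ?_) h'.K_closed
    have hxC := interior_mono h.K_sub hx
    refine h'.mem_K_of_one_le (interior_subset hxC) ?_
    rw [← hg x hxC]
    exact h.one_le_gK (interior_subset hx)
  exact (key _ _ h₀ h₁ hg).antisymm (key _ _ h₁ h₀ fun x hx => (hg x hx).symm)

end final

/-- Minkowski-type uniqueness theorem: two `C`-close sets with the same surface
area measure on `Ω_C = S^{n-1} ∩ int C°` coincide. -/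
theorem cclose_surface_measure_unique {n : ℕ} (hn : 2 ≤ n)
    (C K₀ K₁ : Set (EuclideanSpace ℝ (Fin n)))
    (hC_closed : IsClosed C) (hC_conv : Convex ℝ C)
    (hC_cone : ∀ x ∈ C, ∀ r : ℝ, 0 ≤ r → r • x ∈ C)
    (hC_pointed : C ∩ (-C) = {0})
    (hC_int : (interior C).Nonempty)
    (hK₀C : K₀ ⊆ C) (hK₀closed : IsClosed K₀) (hK₀conv : Convex ℝ K₀)
    (hK₁C : K₁ ⊆ C) (hK₁closed : IsClosed K₁) (hK₁conv : Convex ℝ K₁)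
    (hA₀pos : 0 < volume (C \ K₀)) (hA₀fin : volume (C \ K₀) < ⊤)
    (hA₁pos : 0 < volume (C \ K₁)) (hA₁fin : volume (C \ K₁) < ⊤)
    (hS : ∀ ω : Set (EuclideanSpace ℝ (Fin n)), MeasurableSet ω →
      ω ⊆ Metric.sphere (0 : EuclideanSpace ℝ (Fin n)) 1 ∩
        interior {x : EuclideanSpace ℝ (Fin n) | ∀ y ∈ C, ⟪x, y⟫ ≤ 0} →
      μH[((n : ℝ) - 1)] (revSphImage K₀ ω) = μH[((n : ℝ) - 1)] (revSphImage K₁ ω)) :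
    K₀ = K₁ := by
  have h₀ : CClose C K₀ := ⟨hC_closed, hC_conv, hC_cone, hC_int, hK₀C, hK₀closed, hK₀conv,
    hA₀pos, hA₀fin, hn⟩
  have h₁ : CClose C K₁ := ⟨hC_closed, hC_conv, hC_cone, hC_int, hK₁C, hK₁closed, hK₁conv,
    hA₁pos, hA₁fin, hn⟩
  exact h₀.unique h₁ hS
end
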